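/- arXiv:1504.00046 — 9 statements merged into one kernel-verified Lean document; each statement's English description precedes it below -/
import Mathlib

section
/- Let A be a C*-algebra, let n ≥ 1, and let d₁, …, dₙ ∈ A satisfy Σ_{i=1}^n d_i = 0. Then there exist X, Y ∈ Mₙ(A) with ‖X‖·‖Y‖ ≤ 4n·max_i ‖d_i‖ such that the main diagonal of the commutator [X,Y] = XY − YX equals (d₁, …, dₙ), i.e. (XY − YX)_{ii} = d_i for every i = 1, …, n. -/
open Matrix

section Functional

variable {A : Type*} [NonUnitalCStarAlgebra A]

/-- A self-adjoint element factors as `|a|^{1/2} · (sgn a) |a|^{1/2}`, in either order. -/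
theorem exists_commuting_factorization {a : A} (ha : IsSelfAdjoint a) :
    ∃ p q : A, IsSelfAdjoint p ∧ IsSelfAdjoint q ∧ p * q = a ∧ q * p = a ∧
      ‖p‖ ≤ √‖a‖ ∧ ‖q‖ ≤ √‖a‖ := by
  have hmul : ∀ t : ℝ, (√t + √(-t)) * (√t - √(-t)) = t := fun t => by
    rcases le_total 0 t with h | h
    · rw [Real.sqrt_eq_zero_of_nonpos (neg_nonpos.2 h)]
      simp [Real.mul_self_sqrt h]
    · rw [Real.sqrt_eq_zero_of_nonpos h]
      simp [Real.mul_self_sqrt (neg_nonneg.2 h)]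
  have hbound : ∀ t ∈ quasispectrum ℝ a,
      ‖√t + √(-t)‖ ≤ √‖a‖ ∧ ‖√t - √(-t)‖ ≤ √‖a‖ := fun t ht => by
    have htn : |t| ≤ ‖a‖ :=
      NonUnitalIsometricContinuousFunctionalCalculus.norm_quasispectrum_le a ht ha
    have hs := Real.sqrt_le_sqrt htn
    rcases le_total 0 t with h | h
    · rw [Real.sqrt_eq_zero_of_nonpos (neg_nonpos.2 h)]
      rw [abs_of_nonneg h] at hs
      simpa [abs_of_nonneg (Real.sqrt_nonneg t)] using hs
    · rw [Real.sqrt_eq_zero_of_nonpos h]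
      rw [abs_of_nonpos h] at hs
      simpa [abs_of_nonneg (Real.sqrt_nonneg (-t))] using hs
  have hprod : cfcₙ (fun t : ℝ => √t + √(-t)) a * cfcₙ (fun t : ℝ => √t - √(-t)) a = a := by
    rw [← cfcₙ_mul (fun t : ℝ => √t + √(-t)) (fun t : ℝ => √t - √(-t)) a]
    simp only [hmul]
    exact cfcₙ_id' ℝ a
  refine ⟨cfcₙ (fun t : ℝ => √t + √(-t)) a, cfcₙ (fun t : ℝ => √t - √(-t)) a,
    cfcₙ_predicate _ _, cfcₙ_predicate _ _, hprod, ?_, ?_, ?_⟩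
  · rw [(cfcₙ_commute_cfcₙ _ _ a).eq, hprod]
  · exact norm_cfcₙ_le fun t ht => (hbound t ht).1
  · exact norm_cfcₙ_le fun t ht => (hbound t ht).2

/-- If `p` is self-adjoint of norm at most `r`, then `p²` is the real part of an element `z`
with `z* z = r² p²`. -/
theorem exists_star_mul_self_eq_smul {p : A} (hp : IsSelfAdjoint p) {r : ℝ} (hr : ‖p‖ ≤ r) :
    ∃ z : A, star z * z = ((r ^ 2 : ℝ) : ℂ) • (p * p) ∧ z + star z = (2 : ℂ) • (p * p) := by
  let f : ℝ → ℝ := fun t => √(r ^ 2 * (t * t) - t * t * (t * t))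
  have hf : Continuous f := by fun_prop
  have hf0 : f 0 = 0 := by simp [f]
  set y := cfcₙ f p with hy
  have hysa : IsSelfAdjoint y := cfcₙ_predicate _ _
  have hpp : cfcₙ (fun t : ℝ => t * t) p = p * p := by
    rw [cfcₙ_mul (fun t : ℝ => t) (fun t : ℝ => t) p, cfcₙ_id' ℝ p]
  have hcomm : p * p * y = y * (p * p) := by
    rw [← hpp]
    exact (cfcₙ_commute_cfcₙ _ _ p).eq
  have hsq : p * p * (p * p) + y * y = ((r ^ 2 : ℝ) : ℂ) • (p * p) := by
    rw [Complex.coe_smul, ← hpp, ← cfcₙ_mul (fun t : ℝ => t * t) (fun t : ℝ => t * t) p, hy,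
      ← cfcₙ_mul f f p hf.continuousOn hf0 hf.continuousOn hf0,
      ← cfcₙ_add (fun t : ℝ => t * t * (t * t)) (fun t => f t * f t) p (by fun_prop) (by simp)
        (by fun_prop) (by simp [hf0]),
      ← cfcₙ_const_mul (r ^ 2) (fun t : ℝ => t * t) p]
    refine cfcₙ_congr fun t ht => ?_
    have htn : |t| ≤ r :=
      (NonUnitalIsometricContinuousFunctionalCalculus.norm_quasispectrum_le p ht hp).trans hr
    have ht2 : t * t ≤ r ^ 2 := by
      rw [← abs_mul_abs_self t]
      nlinarith [abs_nonneg t]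
    simp only [f]
    rw [Real.mul_self_sqrt (by nlinarith [mul_self_nonneg t])]
    ring
  refine ⟨p * p + Complex.I • y, ?_, ?_⟩
  · have hII : Complex.I • Complex.I • (y * y) = -(y * y) := by
      rw [smul_smul, Complex.I_mul_I, neg_one_smul]
    rw [← hsq]
    simp only [star_add, star_mul, star_smul, hp.star_eq, hysa.star_eq, Complex.star_def,
      Complex.conj_I, add_mul, mul_add, smul_mul_assoc, mul_smul_comm, neg_smul, neg_mul, smul_add,
      smul_neg, hII, hcomm]
    abel
  · simp only [star_add, star_mul, star_smul, hp.star_eq, hysa.star_eq, Complex.star_def,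
      Complex.conj_I, two_smul, neg_smul]
    abel

end Functional

section WeightedShift

variable {A : Type*} [NonUnitalCStarAlgebra A] {n : ℕ}

/-- The upper weighted shift with weights `p 0, p 1, …` on the first superdiagonal. -/
def weightedShift (n : ℕ) (p : ℕ → A) : Matrix (Fin n) (Fin n) A :=
  Matrix.of fun i j => if (i : ℕ) + 1 = j then p i else 0

/-- The sequence `p` delayed by one step, starting with `0`. -/
def delay (p : ℕ → A) : ℕ → A
  | 0 => 0
  | k + 1 => p k

theorem weightedShift_mul_apply_self (p q : ℕ → A) (i : Fin n) :
    (weightedShift n p * weightedShift n q) i i = 0 := by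
  rw [Matrix.mul_apply]
  refine Finset.sum_eq_zero fun j _ => ?_
  simp only [weightedShift, Matrix.of_apply]
  split_ifs <;> first | omega | simp

theorem conjTranspose_weightedShift_mul (p q : ℕ → A) :
    (weightedShift n q)ᴴ * weightedShift n p =
      Matrix.diagonal fun i : Fin n => delay (fun k => star (q k) * p k) i := by
  ext ⟨i, hi⟩ ⟨j, hj⟩
  simp only [Matrix.mul_apply, Matrix.conjTranspose_apply, weightedShift, Matrix.of_apply,
    Matrix.diagonal_apply, Fin.mk.injEq]
  cases i with
  | zero => simp [delay]
  | succ k =>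
    rw [Finset.sum_eq_single ⟨k, by omega⟩]
    · by_cases h : k + 1 = j <;> simp [delay, h]
    · intro b _ hb
      have : (b : ℕ) ≠ k := fun h => hb (Fin.ext h)
      simp [this]
    · simp

theorem weightedShift_mul_conjTranspose_apply_self (p q : ℕ → A) (i : Fin n)
    (hlast : p (n - 1) * star (q (n - 1)) = 0) :
    (weightedShift n p * (weightedShift n q)ᴴ) i i = p i * star (q i) := by
  simp only [Matrix.mul_apply, Matrix.conjTranspose_apply, weightedShift, Matrix.of_apply]
  by_cases h : (i : ℕ) + 1 < n
  · rw [Finset.sum_eq_single ⟨i + 1, h⟩]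
    · simp
    · intro b _ hb
      have : (i : ℕ) + 1 ≠ b := fun h => hb (Fin.ext h.symm)
      simp [this]
    · simp
  · have hi : (i : ℕ) = n - 1 := by omega
    rw [hi, hlast]
    refine Finset.sum_eq_zero fun b _ => ?_
    have : n - 1 + 1 ≠ (b : ℕ) := by omega
    simp [this]

end WeightedShift

/-- The axioms of a (possibly incomplete) C*-seminorm on a complex star algebra. -/
structure IsCStarSeminorm {B : Type*} [NonUnitalRing B] [StarRing B] [Module ℂ B]
    (N : B → ℝ) : Prop where
  nonneg : ∀ x, 0 ≤ N x
  add_le : ∀ x y, N (x + y) ≤ N x + N y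
  smul : ∀ (c : ℂ) (x), N (c • x) = ‖c‖ * N x
  mul_le : ∀ x y, N (x * y) ≤ N x * N y
  star_mul_self : ∀ x, N (star x * x) = N x * N x

namespace IsCStarSeminorm

theorem star_eq {B : Type*} [NonUnitalRing B] [StarRing B] [Module ℂ B] {N : B → ℝ}
    (hN : IsCStarSeminorm N) (x : B) : N (star x) = N x := by
  have key : ∀ x, N x ≤ N (star x) := fun x => by
    rcases (hN.nonneg x).eq_or_lt with h | h
    · rw [← h]
      exact hN.nonneg _
    · refine le_of_mul_le_mul_right ?_ h
      rw [← hN.star_mul_self]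
      exact hN.mul_le _ _
  exact le_antisymm (by simpa using key (star x)) (key x)

variable {A : Type*} [NonUnitalCStarAlgebra A] {n : ℕ} {N : Matrix (Fin n) (Fin n) A → ℝ}

theorem diagonal_mul_self_le (hN : IsCStarSeminorm N) {p : Fin n → A} {r : ℝ}
    (hp : ∀ i, IsSelfAdjoint (p i)) (hr : ∀ i, ‖p i‖ ≤ r) :
    N (Matrix.diagonal fun i => p i * p i) ≤ r ^ 2 := by
  choose z hz hz' using fun i => exists_star_mul_self_eq_smul (hp i) (hr i)
  set D := Matrix.diagonal fun i => p i * p i with hD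
  set Z := Matrix.diagonal z with hZ
  have h₁ : star Z * Z = ((r ^ 2 : ℝ) : ℂ) • D := by
    rw [hZ, Matrix.star_eq_conjTranspose, Matrix.diagonal_conjTranspose,
      Matrix.diagonal_mul_diagonal, hD, ← Matrix.diagonal_smul]
    exact congrArg _ (funext hz)
  have h₂ : Z + star Z = (2 : ℂ) • D := by
    rw [hZ, Matrix.star_eq_conjTranspose, Matrix.diagonal_conjTranspose,
      Matrix.diagonal_add, hD, ← Matrix.diagonal_smul]
    exact congrArg _ (funext hz')
  have h₃ : N Z * N Z = r ^ 2 * N D := by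
    rw [← hN.star_mul_self, h₁, hN.smul, Complex.norm_real, Real.norm_of_nonneg (sq_nonneg r)]
  have h₄ : N D ≤ N Z := by
    have h := hN.add_le Z (star Z)
    rw [h₂, hN.smul, hN.star_eq, Complex.norm_ofNat] at h
    linarith
  rcases (hN.nonneg D).eq_or_lt with h | h
  · rw [← h]
    positivity
  · refine le_of_mul_le_mul_right ?_ h
    nlinarith [hN.nonneg Z]

theorem weightedShift_le (hN : IsCStarSeminorm N) {p : ℕ → A} {r : ℝ} (hr0 : 0 ≤ r)
    (hp : ∀ k, IsSelfAdjoint (p k)) (hr : ∀ k, k < n → ‖p k‖ ≤ r) :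
    N (weightedShift n p) ≤ r := by
  refine abs_le_of_sq_le_sq' ?_ hr0 |>.2
  rw [sq, ← hN.star_mul_self, Matrix.star_eq_conjTranspose, conjTranspose_weightedShift_mul]
  have hd : (fun i : Fin n => delay (fun k => star (p k) * p k) i) =
      fun i : Fin n => delay p i * delay p i := by
    funext ⟨i, hi⟩
    cases i <;> simp [delay, (hp _).star_eq]
  rw [hd]
  refine hN.diagonal_mul_self_le (fun ⟨i, hi⟩ => ?_) fun ⟨i, hi⟩ => ?_
  · cases i with
    | zero => exact IsSelfAdjoint.zero A
    | succ k => exact hp k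
  · cases i with
    | zero => simpa [delay] using hr0
    | succ k => exact hr k (by omega)

end IsCStarSeminorm

/-- Sequences of elements of norm at most `M` which vanish at `n - 1` have their backward
differences on the diagonal of a commutator of `n × n` matrices. -/
theorem IsCStarSeminorm.exists_commutator_diag_eq_sub_delay
    {A : Type*} [NonUnitalCStarAlgebra A] {n : ℕ} {N : Matrix (Fin n) (Fin n) A → ℝ}
    (hN : IsCStarSeminorm N) (s : ℕ → A) {M : ℝ} (hM : 0 ≤ M) (hs : ∀ k, k < n → ‖s k‖ ≤ M)
    (hlast : s (n - 1) = 0) :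
    ∃ X Y : Matrix (Fin n) (Fin n) A, N X * N Y ≤ 4 * M ∧
      ∀ i : Fin n, (X * Y - Y * X) i i = s i - delay s i := by
  choose p q hp hq hpq hqp hpn hqn using fun k =>
    exists_commuting_factorization (realPart (s k)).2
  choose u v hu hv huv hvu hun hvn using fun k =>
    exists_commuting_factorization (imaginaryPart (s k)).2
  have hre : ∀ k, k < n → √‖(realPart (s k) : A)‖ ≤ √M := fun k hk =>
    Real.sqrt_le_sqrt ((realPart.norm_le (s k)).trans (hs k hk))
  have him : ∀ k, k < n → √‖(imaginaryPart (s k) : A)‖ ≤ √M := fun k hk =>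
    Real.sqrt_le_sqrt ((imaginaryPart.norm_le (s k)).trans (hs k hk))
  have hP := hN.weightedShift_le (Real.sqrt_nonneg M) hp fun k hk => (hpn k).trans (hre k hk)
  have hQ := hN.weightedShift_le (Real.sqrt_nonneg M) hq fun k hk => (hqn k).trans (hre k hk)
  have hU := hN.weightedShift_le (Real.sqrt_nonneg M) hu fun k hk => (hun k).trans (him k hk)
  have hV := hN.weightedShift_le (Real.sqrt_nonneg M) hv fun k hk => (hvn k).trans (him k hk)
  have hlast₁ : p (n - 1) * star (q (n - 1)) = 0 := by
    rw [(hq _).star_eq, hpq, hlast]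
    simp
  have hlast₂ : u (n - 1) * star (v (n - 1)) = 0 := by
    rw [(hv _).star_eq, huv, hlast]
    simp
  refine ⟨weightedShift n p + (-Complex.I) • (weightedShift n v)ᴴ,
    weightedShift n u + (weightedShift n q)ᴴ, ?_, fun i => ?_⟩
  · have hX : N (weightedShift n p + (-Complex.I) • (weightedShift n v)ᴴ) ≤ 2 * √M := by
      refine (hN.add_le _ _).trans ?_
      rw [hN.smul, ← Matrix.star_eq_conjTranspose, hN.star_eq]
      simp only [norm_neg, Complex.norm_I]
      linarith
    have hY : N (weightedShift n u + (weightedShift n q)ᴴ) ≤ 2 * √M := by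
      refine (hN.add_le _ _).trans ?_
      rw [← Matrix.star_eq_conjTranspose, hN.star_eq]
      linarith
    calc _ ≤ 2 * √M * (2 * √M) := mul_le_mul hX hY (hN.nonneg _) (by positivity)
      _ = 4 * (√M * √M) := by ring
      _ = 4 * M := by rw [Real.mul_self_sqrt hM]
  · have hlow : ∀ f g : ℕ → A,
        ((weightedShift n f)ᴴ * (weightedShift n g)ᴴ) i i = 0 := fun f g => by
      rw [← Matrix.conjTranspose_mul, Matrix.conjTranspose_apply, weightedShift_mul_apply_self,
        star_zero]
    have hdelay : delay s i = delay (fun k => star (q k) * p k) i +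
        Complex.I • delay (fun k => star (v k) * u k) i := by
      cases (i : ℕ) with
      | zero => simp [delay]
      | succ k =>
        simp only [delay, (hq _).star_eq, (hv _).star_eq, hqp, hvu]
        exact (realPart_add_I_smul_imaginaryPart (s k)).symm
    have hcur : s i = p i * star (q i) + Complex.I • (u i * star (v i)) := by
      simp only [(hq _).star_eq, (hv _).star_eq, hpq, huv]
      exact (realPart_add_I_smul_imaginaryPart (s i)).symm
    rw [hdelay, hcur]
    simp only [add_mul, mul_add, Matrix.sub_apply, Matrix.add_apply, smul_mul_assoc,
      mul_smul_comm, Matrix.smul_apply, hlow, weightedShift_mul_apply_self,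
      weightedShift_mul_conjTranspose_apply_self p q i hlast₁,
      weightedShift_mul_conjTranspose_apply_self u v i hlast₂,
      conjTranspose_weightedShift_mul, Matrix.diagonal_apply_eq, neg_smul,
      neg_mul, mul_neg, Matrix.neg_apply, smul_zero]
    abel_nf

/-- Let `A` be a C*-algebra, `n ≥ 1`, and `d₁, …, dₙ ∈ A` with
`Σ dᵢ = 0`.  Then there are `X, Y ∈ Mₙ(A)` with `‖X‖·‖Y‖ ≤ 4n·maxᵢ ‖dᵢ‖` whose
commutator `XY − YX` has main diagonal `(d₁, …, dₙ)`.  Here the norm on `Mₙ(A)` is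
represented by an arbitrary function `Nm` satisfying the axioms of a C*-norm on
`Mₙ(A)` (such a norm exists and is unique). -/
theorem statement0 {A : Type*} [NonUnitalCStarAlgebra A] (n : ℕ) (hn : 0 < n)
    (Nm : Matrix (Fin n) (Fin n) A → ℝ)
    (hNnonneg : ∀ X, 0 ≤ Nm X)
    (hNdef : ∀ X, Nm X = 0 ↔ X = 0)
    (hNadd : ∀ X Y, Nm (X + Y) ≤ Nm X + Nm Y)
    (hNsmul : ∀ (c : ℂ) (X), Nm (c • X) = ‖c‖ * Nm X)
    (hNmul : ∀ X Y, Nm (X * Y) ≤ Nm X * Nm Y)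
    (hNcstar : ∀ X, Nm (X.conjTranspose * X) = Nm X * Nm X)
    (d : Fin n → A) (hd : ∑ i, d i = 0) :
    ∃ X Y : Matrix (Fin n) (Fin n) A,
      Nm X * Nm Y ≤ 4 * n * (⨆ i, ‖d i‖) ∧
      ∀ i, (X * Y - Y * X) i i = d i := by
  let ext : ℕ → A := fun k => if h : k < n then d ⟨k, h⟩ else 0
  let s : ℕ → A := fun k => ∑ j ∈ Finset.range (k + 1), ext j
  set D := ⨆ i, ‖d i‖
  have hdD : ∀ i, ‖d i‖ ≤ D := fun i => le_ciSup (Set.finite_range fun i => ‖d i‖).bddAbove i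
  have hD : 0 ≤ D := (norm_nonneg _).trans (hdD ⟨0, hn⟩)
  have hextD : ∀ k, ‖ext k‖ ≤ D := fun k => by
    by_cases h : k < n
    · simpa [ext, h] using hdD ⟨k, h⟩
    · simpa [ext, h] using hD
  have hs : ∀ k, k < n → ‖s k‖ ≤ n * D := fun k hk => by
    have h₁ : ‖s k‖ ≤ ((k + 1 : ℕ) : ℝ) * D := by
      simpa using norm_sum_le_of_le (Finset.range (k + 1)) fun j _ => hextD j
    have h₂ : ((k + 1 : ℕ) : ℝ) ≤ n := by exact_mod_cast hk
    exact h₁.trans (mul_le_mul_of_nonneg_right h₂ hD)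
  have hlast : s (n - 1) = 0 := by
    simp only [s]
    rw [Nat.sub_add_cancel hn, Finset.sum_range, ← hd]
    exact Finset.sum_congr rfl fun i _ => by simp [ext]
  have hN : IsCStarSeminorm Nm := ⟨hNnonneg, hNadd, hNsmul, hNmul, hNcstar⟩
  obtain ⟨X, Y, hXY, hdiag⟩ :=
    hN.exists_commutator_diag_eq_sub_delay s (mul_nonneg n.cast_nonneg hD) hs hlast
  refine ⟨X, Y, by rwa [mul_assoc], fun ⟨i, hi⟩ => ?_⟩
  rw [hdiag]
  cases i with
  | zero => simp [s, ext, delay, hn]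
  | succ k => simp [s, ext, delay, hi, Finset.sum_range_succ _ (k + 1)]
end

section
/- Let A be a unital C*-algebra, let n ≥ 1, and let h = (h_{j,k})_{j,k=1}^n ∈ Mₙ(A). Suppose that for each j = 1, …, n the diagonal entry h_{j,j} equals [x_j, y_j] for some x_j, y_j ∈ A. Then there exist X, Y ∈ Mₙ(A) such that h = [X, Y] and ‖X‖·‖Y‖ ≤ 36n²(n−1)‖h‖ + 3n·Σ_{k=1}^n ‖x_k‖·‖y_k‖. -/
lemma CStarAlgebra.norm_one_le_one (A : Type*) [CStarAlgebra A] : ‖(1 : A)‖ ≤ 1 := by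
  cases subsingleton_or_nontrivial A
  · simp [Subsingleton.elim (1 : A) 0]
  · simp

/-- The axioms of a (submultiplicative) C*-norm, for a real-valued function on a star algebra. -/
structure IsCStarNorm {B : Type*} [NonUnitalRing B] [StarRing B] [Module ℂ B]
    (p : B → ℝ) : Prop where
  nonneg : ∀ a, 0 ≤ p a
  eq_zero_iff : ∀ a, p a = 0 ↔ a = 0
  add_le : ∀ a b, p (a + b) ≤ p a + p b
  smul : ∀ (c : ℂ) (a), p (c • a) = ‖c‖ * p a
  mul_le : ∀ a b, p (a * b) ≤ p a * p b
  star_mul_self : ∀ a, p (star a * a) = p a * p a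

namespace IsCStarNorm

section Comap

variable {B C : Type*} [NonUnitalRing B] [StarRing B] [Module ℂ B]
  [NonUnitalRing C] [StarRing C] [Module ℂ C] {p : C → ℝ}

lemma comap (hp : IsCStarNorm p) (φ : B →⋆ₙₐ[ℂ] C) (hφ : Function.Injective φ) :
    IsCStarNorm (p ∘ φ) where
  nonneg a := hp.nonneg _
  eq_zero_iff a := by simp [hp.eq_zero_iff, map_eq_zero_iff φ hφ]
  add_le a b := by simpa using hp.add_le (φ a) (φ b)
  smul c a := by simpa using hp.smul c (φ a)
  mul_le a b := by simpa using hp.mul_le (φ a) (φ b)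
  star_mul_self a := by simpa [map_star] using hp.star_mul_self (φ a)

lemma sum_le (hp : IsCStarNorm p) {ι : Type*} (s : Finset ι) (f : ι → C) :
    p (∑ i ∈ s, f i) ≤ ∑ i ∈ s, p (f i) :=
  Finset.le_sum_of_subadditive p ((hp.eq_zero_iff 0).2 rfl).le hp.add_le s f

end Comap

variable {B : Type*} [CStarAlgebra B] {p : B → ℝ}

lemma one_le_one (hp : IsCStarNorm p) : p 1 ≤ 1 := by
  have h := hp.star_mul_self 1
  rw [star_one, one_mul] at h
  nlinarith [hp.nonneg 1]

lemma le_one_of_mem_unitary (hp : IsCStarNorm p) {u : B} (hu : u ∈ unitary B) : p u ≤ 1 := by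
  have h := hp.star_mul_self u
  rw [Unitary.star_mul_self_of_mem hu] at h
  nlinarith [hp.nonneg u, hp.one_le_one]

lemma le_one_of_isSelfAdjoint (hp : IsCStarNorm p) {s : B} (hs : IsSelfAdjoint s)
    (h : ‖s‖ ≤ 1) : p s ≤ 1 := by
  let _ : PartialOrder B := CStarAlgebra.spectralOrder B
  have _ : StarOrderedRing B := CStarAlgebra.spectralOrderedRing B
  let u := selfAdjoint.unitarySelfAddISMul (⟨s, hs⟩ : selfAdjoint B) h
  have hu : s = (2⁻¹ : ℂ) • ((u : B) + star (u : B)) := by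
    rw [selfAdjoint.star_coe_unitarySelfAddISMul _ h, selfAdjoint.unitarySelfAddISMul_coe _ h,
      add_add_sub_cancel, ← two_smul ℂ, smul_smul]
    simp
  have h1 := hp.le_one_of_mem_unitary u.2
  have h2 := hp.le_one_of_mem_unitary (Unitary.star_mem u.2)
  have h3 := hp.add_le (u : B) (star (u : B))
  rw [hu, hp.smul]
  norm_num
  linarith

lemma le_norm_of_isSelfAdjoint (hp : IsCStarNorm p) {s : B} (hs : IsSelfAdjoint s) :
    p s ≤ ‖s‖ := by
  rcases eq_or_ne s 0 with rfl | h0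
  · simp [(hp.eq_zero_iff 0).2 rfl]
  have hpos : 0 < ‖s‖ := norm_pos_iff.2 h0
  have hs' : IsSelfAdjoint (((‖s‖⁻¹ : ℝ) : ℂ) • s) :=
    IsSelfAdjoint.smul (by simp [isSelfAdjoint_iff]) hs
  have h := hp.le_one_of_isSelfAdjoint hs' (by simp [norm_smul, hpos.ne'])
  rw [hp.smul, Complex.norm_real, norm_inv, norm_norm, inv_mul_le_iff₀ hpos, mul_one] at h
  exact h

lemma le_norm (hp : IsCStarNorm p) (a : B) : p a ≤ ‖a‖ := by
  have h := hp.le_norm_of_isSelfAdjoint (IsSelfAdjoint.star_mul_self a)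
  rw [hp.star_mul_self, CStarRing.norm_star_mul_self] at h
  exact abs_le_of_sq_le_sq' (by nlinarith) (norm_nonneg a) |>.2

lemma norm_le_of_nonneg [PartialOrder B] [StarOrderedRing B] (hp : IsCStarNorm p) {s : B}
    (hs : 0 ≤ s) : ‖s‖ ≤ p s := by
  cases subsingleton_or_nontrivial B
  · simpa [Subsingleton.elim s 0] using hp.nonneg 0
  by_contra! hlt
  obtain ⟨r, hr, hrs⟩ := exists_between hlt
  have hr0 : 0 < r := (hp.nonneg s).trans_lt hr
  have hu : Continuous fun t : ℝ ↦ (max t r)⁻¹ :=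
    (continuous_id.max continuous_const).inv₀ fun t ↦ (hr0.trans_le (le_max_right t r)).ne'
  set g : B := cfc (fun t : ℝ ↦ max (t - r) 0) s with hg
  set u : B := cfc (fun t : ℝ ↦ (max t r)⁻¹) s
  have hmul : s * (u * g) = g := by
    have h1 : u * g = cfc (fun t : ℝ ↦ (max t r)⁻¹ * max (t - r) 0) s :=
      (cfc_mul _ _ s hu.continuousOn (by fun_prop)).symm
    have h2 : s * (u * g) = cfc (fun t : ℝ ↦ t * ((max t r)⁻¹ * max (t - r) 0)) s := by
      rw [h1, cfc_mul (fun t : ℝ ↦ t) (fun t : ℝ ↦ (max t r)⁻¹ * max (t - r) 0) s (by fun_prop)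
          (hu.continuousOn.mul (by fun_prop)),
        cfc_id' ℝ s]
    rw [h2]
    refine cfc_congr fun t _ ↦ ?_
    rcases le_total t r with h | h
    · simp [h]
    · have : t ≠ 0 := (hr0.trans_le h).ne'
      simp [h, this]
  have hun : p u ≤ r⁻¹ := (hp.le_norm u).trans <| norm_cfc_le (by positivity) fun t _ ↦ by
    rw [norm_inv, Real.norm_of_nonneg (hr0.le.trans (le_max_right t r))]
    exact inv_anti₀ hr0 (le_max_right t r)
  have hpg : p g = 0 := by
    have h1 : p g ≤ p s * (r⁻¹ * p g) :=
      calc p g = p (s * (u * g)) := by rw [hmul]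
        _ ≤ p s * (p u * p g) :=
          (hp.mul_le _ _).trans (mul_le_mul_of_nonneg_left (hp.mul_le _ _) (hp.nonneg _))
        _ ≤ _ := by gcongr <;> exact hp.nonneg _
    have h2 : p s * r⁻¹ < 1 := by rwa [mul_inv_lt_iff₀ hr0, one_mul]
    nlinarith [hp.nonneg g]
  have hmem := CStarAlgebra.norm_mem_spectrum_of_nonneg hs
  have hle := norm_apply_le_norm_cfc (fun t : ℝ ↦ max (t - r) 0) s hmem
  rw [← hg, (hp.eq_zero_iff g).1 hpg, norm_zero, norm_le_zero_iff] at hle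
  have := le_max_left (‖s‖ - r) 0
  linarith

lemma eq_norm (hp : IsCStarNorm p) (a : B) : p a = ‖a‖ := by
  let _ : PartialOrder B := CStarAlgebra.spectralOrder B
  have _ : StarOrderedRing B := CStarAlgebra.spectralOrderedRing B
  refine le_antisymm (hp.le_norm a) ?_
  have h := hp.norm_le_of_nonneg (star_mul_self_nonneg a)
  rw [hp.star_mul_self, CStarRing.norm_star_mul_self] at h
  exact abs_le_of_sq_le_sq' (by nlinarith) (hp.nonneg a) |>.2

section Matrix

variable {A ι : Type*} [CStarAlgebra A] [Fintype ι] [DecidableEq ι] {p : Matrix ι ι A → ℝ}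

lemma diagonal_eq_norm (hp : IsCStarNorm p) (d : ι → A) : p (Matrix.diagonal d) = ‖d‖ :=
  (hp.comap (B := ι → A)
    { toFun := Matrix.diagonal
      map_smul' := fun c d ↦ Matrix.diagonal_smul c d
      map_zero' := Matrix.diagonal_zero
      map_add' := fun d e ↦ (Matrix.diagonal_add d e).symm
      map_mul' := fun d e ↦ (Matrix.diagonal_mul_diagonal d e).symm
      map_star' := fun d ↦ (Matrix.diagonal_conjTranspose d).symm }
    Matrix.diagonal_injective).eq_norm d

lemma single_self_eq_norm (hp : IsCStarNorm p) (i : ι) (a : A) :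
    p (Matrix.single i i a) = ‖a‖ := by
  rw [← Matrix.diagonal_single, hp.diagonal_eq_norm, Pi.norm_single]

lemma single_eq_norm (hp : IsCStarNorm p) (i j : ι) (a : A) :
    p (Matrix.single i j a) = ‖a‖ := by
  have h := hp.star_mul_self (Matrix.single i j a)
  rw [Matrix.star_eq_conjTranspose, Matrix.conjTranspose_single, Matrix.single_mul_single_same,
    hp.single_self_eq_norm, CStarRing.norm_star_mul_self] at h
  exact ((mul_self_inj (norm_nonneg a) (hp.nonneg _)).1 h).symm

lemma norm_apply_le (hp : IsCStarNorm p) (M : Matrix ι ι A) (i j : ι) : ‖M i j‖ ≤ p M := by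
  have h1 : ∀ k : ι, p (Matrix.single k k 1) ≤ 1 := fun k ↦ by
    rw [hp.single_self_eq_norm]
    exact CStarAlgebra.norm_one_le_one A
  have h : Matrix.single i i 1 * M * Matrix.single j j 1 = Matrix.single i j (M i j) := by
    simp [Matrix.single_mul_mul_single]
  rw [← hp.single_eq_norm i j, ← h]
  calc _ ≤ p (Matrix.single i i 1 * M) * p (Matrix.single j j 1) := hp.mul_le _ _
    _ ≤ p (Matrix.single i i 1 * M) := mul_le_of_le_one_right (hp.nonneg _) (h1 j)
    _ ≤ p (Matrix.single i i 1) * p M := hp.mul_le _ _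
    _ ≤ p M := mul_le_of_le_one_left (hp.nonneg _) (h1 i)

lemma le_sum_norm (hp : IsCStarNorm p) (M : Matrix ι ι A) : p M ≤ ∑ i, ∑ j, ‖M i j‖ := by
  conv_lhs => rw [Matrix.matrix_eq_sum_single M]
  refine (hp.sum_le _ _).trans (Finset.sum_le_sum fun i _ ↦ (hp.sum_le _ _).trans ?_)
  simp [hp.single_eq_norm]

end Matrix

end IsCStarNorm

/-- A Sylvester equation whose scalar shift dominates the other coefficients is solvable, with
control on the norm of the solution. -/
lemma exists_smul_add_mul_sub_mul_eq {A : Type*} [CStarAlgebra A] (x y b : A) (hx : ‖x‖ ≤ 1)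
    (hy : ‖y‖ ≤ 1) (c : ℂ) (hc : 3 ≤ ‖c‖) :
    ∃ z : A, c • z + x * z - z * y = b ∧ ‖z‖ ≤ ‖b‖ := by
  have hc0 : c ≠ 0 := norm_pos_iff.1 (by linarith)
  let E : A →L[ℂ] A := ContinuousLinearMap.mul ℂ A x - (ContinuousLinearMap.mul ℂ A).flip y
  have hE : ‖E‖ ≤ 2 := ContinuousLinearMap.opNorm_le_bound _ (by norm_num) fun z ↦ by
    have h1 : ‖x * z‖ ≤ 1 * ‖z‖ := (norm_mul_le _ _).trans (by gcongr)
    have h2 : ‖z * y‖ ≤ ‖z‖ * 1 := (norm_mul_le _ _).trans (by gcongr)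
    have h3 : ‖E z‖ ≤ ‖x * z‖ + ‖z * y‖ := norm_sub_le (x * z) (z * y)
    linarith
  have hlt : ‖-(c⁻¹ • E)‖ < 1 := by
    rw [norm_neg, norm_smul, norm_inv, inv_mul_lt_iff₀ (by linarith)]
    linarith
  let u := Units.oneSub _ hlt
  let z : A := (↑u⁻¹ : A →L[ℂ] A) (c⁻¹ • b)
  have huz : (↑u : A →L[ℂ] A) z = c⁻¹ • b := by
    change ((↑u : A →L[ℂ] A) * (↑u⁻¹ : A →L[ℂ] A)) (c⁻¹ • b) = _
    rw [Units.mul_inv]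
    rfl
  have hz : c • z + E z = b := by
    have h : z + c⁻¹ • E z = c⁻¹ • b := by
      rw [← huz]
      simp [u]
    have h' := congrArg (c • ·) h
    simpa [smul_smul, hc0] using h'
  refine ⟨z, by rw [← hz, add_sub_assoc]; rfl, ?_⟩
  have h1 : ‖E z‖ ≤ 2 * ‖z‖ := (E.le_opNorm z).trans (by gcongr)
  have h2 : ‖c • z‖ ≤ ‖b‖ + ‖E z‖ := by
    rw [← hz]
    simpa using norm_sub_le (c • z + E z) (E z)
  rw [norm_smul] at h2
  nlinarith [norm_nonneg z]

/-- A commutator can be rewritten so that its first entry lies in the unit ball. -/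
lemma exists_norm_le_one_commutator_eq {A : Type*} [CStarAlgebra A] (x y : A) :
    ∃ x' y' : A, x * y - y * x = x' * y' - y' * x' ∧ ‖x'‖ ≤ 1 ∧ ‖y'‖ ≤ ‖x‖ * ‖y‖ := by
  rcases eq_or_ne x 0 with rfl | hx
  · exact ⟨0, 0, by simp⟩
  refine ⟨‖x‖⁻¹ • x, ‖x‖ • y, ?_, ?_, ?_⟩
  · simp [smul_smul, hx]
  · simp [norm_smul, hx]
  · simp [norm_smul]

/-- Let `A` be a unital C*-algebra, `n ≥ 1`, and
`h ∈ Mₙ(A)` a matrix whose diagonal entries are commutators: `h j j = [x j, y j]`.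
Then `h = [X, Y]` for some `X, Y ∈ Mₙ(A)` with
`‖X‖·‖Y‖ ≤ 36n²(n−1)‖h‖ + 3n·Σₖ ‖xₖ‖·‖yₖ‖`.  The (unique) C*-norm of `Mₙ(A)` is
represented by a function `Nm` satisfying the C*-norm axioms. -/
theorem statement1 {A : Type*} [CStarAlgebra A] (n : ℕ) (hn : 0 < n)
    (Nm : Matrix (Fin n) (Fin n) A → ℝ)
    (hNnonneg : ∀ X, 0 ≤ Nm X)
    (hNdef : ∀ X, Nm X = 0 ↔ X = 0)
    (hNadd : ∀ X Y, Nm (X + Y) ≤ Nm X + Nm Y)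
    (hNsmul : ∀ (c : ℂ) (X), Nm (c • X) = ‖c‖ * Nm X)
    (hNmul : ∀ X Y, Nm (X * Y) ≤ Nm X * Nm Y)
    (hNcstar : ∀ X, Nm (X.conjTranspose * X) = Nm X * Nm X)
    (h : Matrix (Fin n) (Fin n) A) (x y : Fin n → A)
    (hdiag : ∀ j, h j j = x j * y j - y j * x j) :
    ∃ X Y : Matrix (Fin n) (Fin n) A,
      h = X * Y - Y * X ∧
      Nm X * Nm Y ≤ 36 * (n : ℝ) ^ 2 * ((n : ℝ) - 1) * Nm h + 3 * n * ∑ k, ‖x k‖ * ‖y k‖ := by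
  have hp : IsCStarNorm Nm := ⟨hNnonneg, hNdef, hNadd, hNsmul, hNmul, hNcstar⟩
  choose x' y' hxy hx' hy' using fun j ↦ exists_norm_le_one_commutator_eq (x j) (y j)
  have hoff : ∀ j k : Fin n, j ≠ k → ∃ z : A,
      (3 * ((j : ℂ) - (k : ℂ))) • z + x' j * z - z * x' k = h j k ∧ ‖z‖ ≤ ‖h j k‖ := by
    intro j k hjk
    refine exists_smul_add_mul_sub_mul_eq _ _ _ (hx' j) (hx' k) _ ?_
    have h1 : (1 : ℤ) ≤ |(j : ℤ) - (k : ℤ)| := Int.one_le_abs (by omega)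
    have h2 : ‖((j : ℂ) - (k : ℂ))‖ = ((|(j : ℤ) - (k : ℤ)| : ℤ) : ℝ) := by
      rw [Int.cast_abs, ← Complex.norm_intCast]
      push_cast
      rfl
    rw [norm_mul, h2]
    have h3 : (1 : ℝ) ≤ ((|(j : ℤ) - (k : ℤ)| : ℤ) : ℝ) := by exact_mod_cast h1
    simpa using h3
  choose z hz hzn using hoff
  let d : Fin n → A := fun j ↦ x' j + (3 * (j : ℂ)) • (1 : A)
  let Y : Matrix (Fin n) (Fin n) A := .of fun j k ↦ if hjk : j = k then y' j else z j k hjk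
  have hd : ‖d‖ ≤ 3 * n := by
    refine (pi_norm_le_iff_of_nonneg (by positivity)).2 fun j ↦ ?_
    have h1 : ‖(3 * (j : ℂ)) • (1 : A)‖ ≤ 3 * (j : ℝ) := by
      rw [norm_smul]
      simpa using mul_le_of_le_one_right (by positivity : 0 ≤ 3 * (j : ℝ))
        (CStarAlgebra.norm_one_le_one A)
    have h2 : (j : ℝ) + 1 ≤ n := by exact_mod_cast j.2
    have h3 := norm_add_le (x' j) ((3 * (j : ℂ)) • (1 : A))
    have h4 := hx' j
    change ‖x' j + (3 * (j : ℂ)) • (1 : A)‖ ≤ _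
    linarith
  have hY : Nm Y ≤ ∑ k, ‖x k‖ * ‖y k‖ + n * (n - 1) * Nm h := by
    calc Nm Y ≤ ∑ j, ∑ k, ‖Y j k‖ := hp.le_sum_norm Y
      _ ≤ ∑ j, ∑ k, ((if j = k then ‖x j‖ * ‖y j‖ - Nm h else 0) + Nm h) := by
        refine Finset.sum_le_sum fun j _ ↦ Finset.sum_le_sum fun k _ ↦ ?_
        by_cases hjk : j = k
        · simpa [Y, hjk] using hy' k
        · simpa [Y, hjk] using (hzn j k hjk).trans (hp.norm_apply_le h j k)
      _ = _ := by
        simp [Finset.sum_add_distrib]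
        ring
  refine ⟨Matrix.diagonal d, Y, ?_, ?_⟩
  · ext j k
    rw [Matrix.sub_apply, Matrix.diagonal_mul, Matrix.mul_diagonal]
    by_cases hjk : j = k
    · subst hjk
      simp [Y, d, hdiag, hxy, add_mul, mul_add]
    · simp only [Y, d, Matrix.of_apply, hjk, dite_false]
      rw [← hz j k hjk, mul_sub, sub_smul]
      simp only [add_mul, mul_add, smul_mul_assoc, mul_smul_comm, one_mul, mul_one]
      abel
  · rw [hp.diagonal_eq_norm]
    have hn1 : (1 : ℝ) ≤ n := by exact_mod_cast hn
    have h1 : 0 ≤ (n : ℝ) ^ 2 * ((n : ℝ) - 1) * Nm h :=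
      mul_nonneg (mul_nonneg (sq_nonneg _) (by linarith)) (hNnonneg h)
    have h2 := mul_le_mul hd hY (hNnonneg Y) (by positivity)
    nlinarith
end

section
/- Let A be a C*-algebra with commutator bounds (m, C), and let I be a closed two-sided ideal of A. Then I (regarded as a C*-algebra in its own right) has commutator bounds (m, C): for every h in the norm-closure of the linear span of commutators of elements of I and every ε > 0, there exist x₁, y₁, …, x_m, y_m ∈ I with ‖h − Σ_{i=1}^m [x_i, y_i]‖ < ε and Σ_{i=1}^m ‖x_i‖·‖y_i‖ ≤ C‖h‖. -/
/-- A C*-algebra `A` has commutator bounds `(m, C)` if every `h` in the norm-closure of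
the linear span of commutators is, up to any `ε > 0`, a sum of `m` commutators
`[xᵢ, yᵢ]` with `Σ ‖xᵢ‖·‖yᵢ‖ ≤ C‖h‖`. -/
def HasCommutatorBounds (A : Type*) [NonUnitalCStarAlgebra A] (m : ℕ) (C : ℝ) : Prop :=
  ∀ h ∈ closure (Submodule.span ℂ {z : A | ∃ x y : A, z = x * y - y * x} : Set A),
    ∀ ε > 0, ∃ x y : Fin m → A,
      ‖h - ∑ i, (x i * y i - y i * x i)‖ < ε ∧
      ∑ i, ‖x i‖ * ‖y i‖ ≤ C * ‖h‖

open Filter Topology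

namespace TwoSidedIdeal

variable {A : Type*} [NonUnitalCStarAlgebra A]

lemma smul_mem_of_isClosed {I : TwoSidedIdeal A} (hI : IsClosed (I : Set A)) (c : ℂ) {z : A}
    (hz : z ∈ I) : c • z ∈ I := by
  let _ := CStarAlgebra.spectralOrder A
  let _ := CStarAlgebra.spectralOrderedRing A
  have hl := (CStarAlgebra.increasingApproximateUnit A).tendsto_mul_right (c • z)
  refine hI.mem_of_tendsto hl (Eventually.of_forall fun u ↦ ?_)
  have : u * (c • z) = (c • u) * z := by rw [mul_smul_comm, smul_mul_assoc]
  simp only [this]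
  exact I.mul_mem_left _ _ hz

/-- The star subalgebra of those elements of a closed two-sided ideal
whose adjoint also lies in the ideal. -/
def starCore (I : TwoSidedIdeal A) (hI : IsClosed (I : Set A)) : NonUnitalStarSubalgebra ℂ A where
  carrier := {x | x ∈ I ∧ star x ∈ I}
  add_mem' hx hy := ⟨I.add_mem hx.1 hy.1, by rw [star_add]; exact I.add_mem hx.2 hy.2⟩
  zero_mem' := ⟨I.zero_mem, by rw [star_zero]; exact I.zero_mem⟩
  mul_mem' hx hy := ⟨I.mul_mem_right _ _ hx.1, by rw [star_mul]; exact I.mul_mem_right _ _ hy.2⟩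
  smul_mem' c x hx := ⟨smul_mem_of_isClosed hI c hx.1, by
    rw [star_smul]; exact smul_mem_of_isClosed hI _ hx.2⟩
  star_mem' hx := ⟨hx.2, by rw [star_star]; exact hx.1⟩

lemma isClosed_starCore (I : TwoSidedIdeal A) (hI : IsClosed (I : Set A)) :
    IsClosed (I.starCore hI : Set A) :=
  hI.inter (hI.preimage continuous_star)

/-- A closed two-sided ideal of a C⋆-algebra has a two-sided approximate unit of selfadjoint
contractions. -/
lemma exists_approximateUnit (I : TwoSidedIdeal A) (hI : IsClosed (I : Set A)) :
    ∃ l : Filter A, l.NeBot ∧ (∀ᶠ e in l, e ∈ I ∧ star e = e ∧ ‖e‖ ≤ 1) ∧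
      (∀ c ∈ I, Tendsto (fun e ↦ e * c) l (𝓝 c)) ∧
      (∀ c ∈ I, Tendsto (fun e ↦ c * e) l (𝓝 c)) := by
  have : IsClosed (I.starCore hI : Set A) := I.isClosed_starCore hI
  let _ : NonUnitalCStarAlgebra (I.starCore hI) :=
    NonUnitalStarSubalgebra.nonUnitalCStarAlgebra (I.starCore hI)
  let _ := CStarAlgebra.spectralOrder (I.starCore hI)
  let _ := CStarAlgebra.spectralOrderedRing (I.starCore hI)
  have hu := CStarAlgebra.increasingApproximateUnit (I.starCore hI)
  set l₀ := CStarAlgebra.approximateUnit (I.starCore hI)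
  let l : Filter A := l₀.map (Subtype.val : I.starCore hI → A)
  have hl : ∀ᶠ e in l, e ∈ I ∧ star e = e ∧ ‖e‖ ≤ 1 := by
    rw [eventually_map]
    filter_upwards [hu.eventually_norm, hu.eventually_star_eq] with e he he'
    exact ⟨e.2.1, congrArg Subtype.val he', he⟩
  have left (d : A) (hd : d ∈ I) (hd' : star d ∈ I) :
      Tendsto (fun e ↦ ‖d - e * d‖) l (𝓝 0) := by
    have h := (continuous_subtype_val.tendsto _).comp (hu.tendsto_mul_right ⟨d, hd, hd'⟩)
    have h' : Tendsto (fun e ↦ e * d) l (𝓝 d) := tendsto_map'_iff.mpr h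
    simpa using (h'.const_sub d).norm
  have right (d : A) (hd : d ∈ I) (hd' : star d ∈ I) :
      Tendsto (fun e ↦ ‖d - d * e‖) l (𝓝 0) := by
    have h := (continuous_subtype_val.tendsto _).comp (hu.tendsto_mul_left ⟨d, hd, hd'⟩)
    have h' : Tendsto (fun e ↦ d * e) l (𝓝 d) := tendsto_map'_iff.mpr h
    simpa using (h'.const_sub d).norm
  refine ⟨l, inferInstance, hl, fun c hc ↦ ?_, fun c hc ↦ ?_⟩
  · have hd : c * star c ∈ I := I.mul_mem_right _ _ hc
    have h0 := (left _ hd (by simpa using hd)).const_mul 2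
    have h1 : Tendsto (fun e ↦ ‖c - e * c‖ ^ 2) l (𝓝 0) := by
      refine squeeze_zero' (Eventually.of_forall fun _ ↦ by positivity) ?_ (by simpa using h0)
      filter_upwards [hl] with e he
      obtain ⟨-, hs, hn⟩ := he
      have key : (c - e * c) * star (c - e * c)
          = (c * star c - e * (c * star c)) - (c * star c - e * (c * star c)) * e := by
        simp only [star_sub, star_mul, hs]; noncomm_ring
      rw [sq, ← CStarRing.norm_self_mul_star, key]
      refine (norm_sub_le _ _).trans ?_
      have := (norm_mul_le (c * star c - e * (c * star c)) e).trans
        (mul_le_of_le_one_right (norm_nonneg _) hn)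
      linarith
    have h2 := h1.sqrt
    simp only [Real.sqrt_sq (norm_nonneg _), Real.sqrt_zero] at h2
    rw [tendsto_iff_norm_sub_tendsto_zero]
    simpa only [norm_sub_rev] using h2
  · have hd : star c * c ∈ I := I.mul_mem_left _ _ hc
    have h0 := (right _ hd (by simpa using hd)).const_mul 2
    have h1 : Tendsto (fun e ↦ ‖c - c * e‖ ^ 2) l (𝓝 0) := by
      refine squeeze_zero' (Eventually.of_forall fun _ ↦ by positivity) ?_ (by simpa using h0)
      filter_upwards [hl] with e he
      obtain ⟨-, hs, hn⟩ := he
      have key : star (c - c * e) * (c - c * e)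
          = (star c * c - star c * c * e) - e * (star c * c - star c * c * e) := by
        simp only [star_sub, star_mul, hs]; noncomm_ring
      rw [sq, ← CStarRing.norm_star_mul_self, key]
      refine (norm_sub_le _ _).trans ?_
      have := (norm_mul_le e (star c * c - star c * c * e)).trans
        (mul_le_of_le_one_left (norm_nonneg _) hn)
      linarith
    have h2 := h1.sqrt
    simp only [Real.sqrt_sq (norm_nonneg _), Real.sqrt_zero] at h2
    rw [tendsto_iff_norm_sub_tendsto_zero]
    simpa only [norm_sub_rev] using h2

/-- The commutators of a sum of `n` suitably chosen approximate unit elements with finitely many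
elements of the algebra grow only like `√n`. -/
lemma exists_sum_approximateUnit_commutator_bound (I : TwoSidedIdeal A)
    (hI : IsClosed (I : Set A)) {ι : Type*} [Finite ι] (x : ι → A) {h : A} (hh : h ∈ I) {δ : ℝ}
    (hδ : 0 < δ) (n : ℕ) :
    ∃ f ∈ I, ‖f‖ ≤ n ∧ ‖(n : ℂ) • h - f * h‖ ≤ n * δ ∧
      ∀ i, ‖f * x i - x i * f‖ ^ 2 ≤ n * (4 * ‖x i‖ ^ 2 + 1) := by
  obtain ⟨l, _, hl, hleft, hright⟩ := I.exists_approximateUnit hI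
  induction n with
  | zero => exact ⟨0, I.zero_mem, by simp⟩
  | succ n ih =>
    obtain ⟨f, hf, hfn, hfh, hfx⟩ := ih
    have h1 : ∀ᶠ e in l, ‖h - e * h‖ < δ := by
      have := ((hleft h hh).const_sub h).norm
      rw [sub_self, norm_zero] at this
      exact this.eventually_lt_const hδ
    have h2 : ∀ᶠ e in l, ∀ i,
        ‖(f * x i - x i * f) * (star (x i) * e - e * star (x i))‖ < 1 / 2 := by
      rw [eventually_all]
      intro i
      have hS : f * x i - x i * f ∈ I :=
        I.sub_mem (I.mul_mem_right _ _ hf) (I.mul_mem_left _ _ hf)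
      have := ((hright _ (I.mul_mem_right _ (star (x i)) hS)).sub
        ((hright _ hS).mul_const (star (x i)))).norm
      rw [sub_self, norm_zero] at this
      filter_upwards [this.eventually_lt_const (show (0 : ℝ) < 1 / 2 by norm_num)] with e he
      rwa [mul_sub, ← mul_assoc, ← mul_assoc]
    obtain ⟨e, ⟨heI, hes, hen⟩, he1, he2⟩ := (hl.and (h1.and h2)).exists
    refine ⟨f + e, I.add_mem hf heI, ?_, ?_, fun i ↦ ?_⟩
    · push_cast
      exact (norm_add_le _ _).trans (add_le_add hfn hen)
    · have : ((n + 1 : ℕ) : ℂ) • h - (f + e) * h = ((n : ℂ) • h - f * h) + (h - e * h) := by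
        push_cast
        rw [add_smul, one_smul, add_mul]; abel
      rw [this]
      refine (norm_add_le _ _).trans ?_
      push_cast
      linarith
    · set S := f * x i - x i * f with hS
      set a := e * x i - x i * e with ha
      have hsum : (f + e) * x i - x i * (f + e) = S + a := by
        rw [hS, ha, add_mul, mul_add]; abel
      have hstar : star a = star (x i) * e - e * star (x i) := by
        rw [ha, star_sub, star_mul, star_mul, hes]
      have hSa : ‖S * star a‖ < 1 / 2 := by rw [hstar]; exact he2 i
      have haS : ‖a * star S‖ < 1 / 2 := by
        rw [← norm_star, star_mul, star_star]; exact hSa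
      have han : ‖a‖ ≤ 2 * ‖x i‖ := by
        have e1 := (norm_mul_le e (x i)).trans (mul_le_of_le_one_left (norm_nonneg _) hen)
        have e2 := (norm_mul_le (x i) e).trans (mul_le_of_le_one_right (norm_nonneg _) hen)
        have := norm_sub_le (e * x i) (x i * e)
        linarith
      have han2 : ‖a‖ ^ 2 ≤ 4 * ‖x i‖ ^ 2 := by
        have := pow_le_pow_left₀ (norm_nonneg a) han 2
        linarith [mul_pow 2 ‖x i‖ 2]
      have hexp : (S + a) * star (S + a) = S * star S + S * star a + a * star S + a * star a := by
        rw [star_add]; noncomm_ring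
      have hn := norm_add₄_le (a := S * star S) (b := S * star a) (c := a * star S)
        (d := a * star a)
      rw [← hexp, CStarRing.norm_self_mul_star, CStarRing.norm_self_mul_star,
        CStarRing.norm_self_mul_star, ← sq, ← sq, ← sq] at hn
      rw [hsum]
      push_cast
      linarith [hfx i]

/-- Closed two-sided ideals of C⋆-algebras have quasi-central approximate units. -/
lemma exists_quasicentral (I : TwoSidedIdeal A) (hI : IsClosed (I : Set A)) {ι : Type*} [Finite ι]
    (x : ι → A) {h : A} (hh : h ∈ I) {δ : ℝ} (hδ : 0 < δ) :
    ∃ e ∈ I, ‖e‖ ≤ 1 ∧ ‖h - e * h‖ ≤ δ ∧ ∀ i, ‖e * x i - x i * e‖ ≤ δ := by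
  have hev : ∀ᶠ n : ℕ in atTop, ∀ i, (4 * ‖x i‖ ^ 2 + 1) / δ ^ 2 ≤ n :=
    eventually_all.mpr fun i ↦ tendsto_natCast_atTop_atTop.eventually_ge_atTop _
  obtain ⟨n, hn, hn0⟩ := (hev.and (eventually_gt_atTop 0)).exists
  obtain ⟨f, hf, hfn, hfh, hfx⟩ := I.exists_sum_approximateUnit_commutator_bound hI x hh hδ n
  have hnR : (0 : ℝ) < n := by exact_mod_cast hn0
  have hnC : (n : ℂ) ≠ 0 := by exact_mod_cast hn0.ne'
  have norm_scale (z : A) : ‖(n : ℂ)⁻¹ • z‖ = ‖z‖ / n := by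
    rw [norm_smul, norm_inv, Complex.norm_natCast, inv_mul_eq_div]
  refine ⟨(n : ℂ)⁻¹ • f, smul_mem_of_isClosed hI _ hf, ?_, ?_, fun i ↦ ?_⟩
  · rw [norm_scale]
    exact div_le_one_of_le₀ hfn hnR.le
  · have : h - (n : ℂ)⁻¹ • f * h = (n : ℂ)⁻¹ • ((n : ℂ) • h - f * h) := by
      rw [smul_sub, inv_smul_smul₀ hnC, smul_mul_assoc]
    rw [this, norm_scale, div_le_iff₀ hnR]
    linarith
  · rw [smul_mul_assoc, mul_smul_comm, ← smul_sub, norm_scale, div_le_iff₀ hnR]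
    refine (sq_le_sq₀ (norm_nonneg _) (by positivity)).mp ?_
    have h1 := (div_le_iff₀ (by positivity)).mp (hn i)
    calc _ ≤ _ := hfx i
      _ ≤ n * (n * δ ^ 2) := by gcongr
      _ = _ := by ring

end TwoSidedIdeal

/-- If a C*-algebra `A` has commutator bounds `(m, C)` and `I` is a
closed two-sided ideal of `A`, then `I` (as a C*-algebra in its own right) has
commutator bounds `(m, C)`: every `h` in the norm-closure of the span of commutators
of elements of `I` is approximated by sums of `m` commutators of elements of `I`,
with the same norm control. -/
theorem statement4 {A : Type*} [NonUnitalCStarAlgebra A] (m : ℕ) (C : ℝ)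
    (hA : HasCommutatorBounds A m C)
    (I : TwoSidedIdeal A) (hI : IsClosed (I : Set A)) :
    ∀ h ∈ closure (Submodule.span ℂ {z : A | ∃ x ∈ I, ∃ y ∈ I, z = x * y - y * x} : Set A),
      ∀ ε > 0, ∃ x y : Fin m → A,
        (∀ i, x i ∈ I ∧ y i ∈ I) ∧
        ‖h - ∑ i, (x i * y i - y i * x i)‖ < ε ∧
        ∑ i, ‖x i‖ * ‖y i‖ ≤ C * ‖h‖ := by
  intro h hh ε hε
  have hhI : h ∈ I := by
    refine closure_minimal (fun z hz ↦ ?_) hI hh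
    induction hz using Submodule.span_induction with
    | mem z hz =>
      obtain ⟨x, hx, y, hy, rfl⟩ := hz
      exact I.sub_mem (I.mul_mem_right _ _ hx) (I.mul_mem_right _ _ hy)
    | zero => exact I.zero_mem
    | add a b _ _ ha hb => exact I.add_mem ha hb
    | smul c a _ ha => exact TwoSidedIdeal.smul_mem_of_isClosed hI c ha
  have hhA : h ∈ closure (Submodule.span ℂ {z : A | ∃ x y : A, z = x * y - y * x} : Set A) := by
    refine closure_mono (Submodule.span_mono ?_) hh
    rintro z ⟨x, -, y, -, rfl⟩
    exact ⟨x, y, rfl⟩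
  obtain ⟨x, y, hxy, hC⟩ := hA h hhA (ε / 2) (half_pos hε)
  set M : ℝ := 2 + ∑ i, (‖x i‖ + ‖y i‖) with hM
  have hMpos : 0 < M := by positivity
  obtain ⟨e, heI, hen, heh, hex⟩ := I.exists_quasicentral hI (Sum.elim x y) hhI
    (δ := ε / 2 / M) (by positivity)
  set δ := ε / 2 / M
  have hδpos : 0 < δ := by positivity
  have e_mul (z : A) : ‖e * z‖ ≤ ‖z‖ :=
    (norm_mul_le _ _).trans (mul_le_of_le_one_left (norm_nonneg _) hen)
  refine ⟨fun i ↦ e * x i, fun i ↦ e * y i,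
    fun i ↦ ⟨I.mul_mem_right _ _ heI, I.mul_mem_right _ _ heI⟩, ?_, ?_⟩
  · have hterm (i : Fin m) : ‖e * (e * (x i * y i - y i * x i)) -
        (e * x i * (e * y i) - e * y i * (e * x i))‖ ≤ δ * (‖x i‖ + ‖y i‖) := by
      have heq : e * (e * (x i * y i - y i * x i)) - (e * x i * (e * y i) - e * y i * (e * x i))
          = e * ((e * x i - x i * e) * y i) - e * ((e * y i - y i * e) * x i) := by
        noncomm_ring
      have h1 := (e_mul ((e * x i - x i * e) * y i)).trans (norm_mul_le _ _)
      have h2 := (e_mul ((e * y i - y i * e) * x i)).trans (norm_mul_le _ _)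
      have h3 := mul_le_mul_of_nonneg_right (hex (.inl i)) (norm_nonneg (y i))
      have h4 := mul_le_mul_of_nonneg_right (hex (.inr i)) (norm_nonneg (x i))
      simp only [Sum.elim_inl, Sum.elim_inr] at h3 h4
      rw [heq]
      refine (norm_sub_le _ _).trans ?_
      linarith
    set s := ∑ i, (x i * y i - y i * x i) with hs
    have hsum : ‖e * (e * s) - ∑ i, (e * x i * (e * y i) - e * y i * (e * x i))‖
        ≤ δ * ∑ i, (‖x i‖ + ‖y i‖) := by
      rw [hs, Finset.mul_sum, Finset.mul_sum, ← Finset.sum_sub_distrib, Finset.mul_sum]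
      exact norm_sum_le_of_le _ fun i _ ↦ hterm i
    have hsplit : h - ∑ i, (e * x i * (e * y i) - e * y i * (e * x i))
        = (h - e * h) + e * (h - e * h) + e * (e * (h - s)) +
          (e * (e * s) - ∑ i, (e * x i * (e * y i) - e * y i * (e * x i))) := by
      simp only [mul_sub]; abel
    have h1 := e_mul (h - e * h)
    have h2 := (e_mul (e * (h - s))).trans (e_mul _)
    have hδM : δ * M = ε / 2 := div_mul_cancel₀ _ hMpos.ne'
    rw [hM, mul_add] at hδM
    rw [hsplit]
    refine norm_add₄_le.trans_lt ?_
    linarith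
  · refine le_trans (Finset.sum_le_sum fun i _ ↦ ?_) hC
    exact mul_le_mul (e_mul _) (e_mul _) (norm_nonneg _) (norm_nonneg _)
end

section
/- Let A be a C*-algebra with commutator bounds (m, C), and let I be a closed two-sided ideal of A. Then the quotient C*-algebra A/I has commutator bounds (m, C): for every h ∈ A/I in the norm-closure of the linear span of commutators of A/I and every ε > 0, there exist x₁, y₁, …, x_m, y_m ∈ A/I with ‖h − Σ_{i=1}^m [x_i, y_i]‖ < ε and Σ_{i=1}^m ‖x_i‖·‖y_i‖ ≤ C‖h‖. -/
open Filter Topology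

section StarHom

variable {A B : Type*} [NonUnitalCStarAlgebra A] [NonUnitalCStarAlgebra B]

open CStarAlgebra in
/-- The kernel of a *-homomorphism of C*-algebras has a contractive approximate unit. -/
lemma NonUnitalStarAlgHom.exists_approximateUnit_ker (φ : A →⋆ₙₐ[ℂ] B) :
    ∃ l : Filter A, l.NeBot ∧ (∀ᶠ e in l, φ e = 0 ∧ ‖e‖ ≤ 1 ∧ ∀ z, ‖z - e * z‖ ≤ ‖z‖) ∧
      ∀ d, φ d = 0 → Tendsto (d * ·) l (𝓝 d) ∧ Tendsto (· * d) l (𝓝 d) := by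
  let J : NonUnitalStarSubalgebra ℂ A := NonUnitalStarSubalgebra.comap φ ⊥
  have hJ (a : A) : a ∈ J ↔ φ a = 0 := by
    simp [J, NonUnitalStarSubalgebra.mem_comap, NonUnitalStarAlgebra.mem_bot]
  have hφ : Continuous φ := map_continuous φ
  have hclosed : IsClosed (J : Set A) := by
    have : (J : Set A) = φ ⁻¹' {0} := by ext a; simpa using hJ a
    rw [this]
    exact isClosed_singleton.preimage hφ
  let _ := spectralOrder A
  have _ := spectralOrderedRing A
  let _ : NonUnitalCStarAlgebra J := NonUnitalStarSubalgebra.nonUnitalCStarAlgebra J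
  let _ := spectralOrder J
  have _ := spectralOrderedRing J
  have hu := increasingApproximateUnit J
  refine ⟨(approximateUnit J).map Subtype.val, inferInstance, ?_, fun d hd ↦ ?_⟩
  · rw [eventually_map]
    filter_upwards [hu.eventually_nonneg, hu.eventually_norm] with e he₀ he₁
    have he₀' : 0 ≤ (e : A) := by
      obtain ⟨x, rfl⟩ := nonneg_iff_eq_star_mul_self.1 he₀
      exact star_mul_self_nonneg (x : A)
    refine ⟨(hJ _).1 e.2, he₁, fun z ↦ ?_⟩
    refine norm_sub_mul_self_le_of_inr z le_rfl he₀' he₁ (norm_nonneg z) ?_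
    rw [Unitization.inr_zero, sub_zero, mul_one, CStarRing.norm_star_mul_self,
      Unitization.norm_inr, sq]
  · have hd' := (hJ d).2 hd
    rw [tendsto_map'_iff, tendsto_map'_iff]
    exact ⟨(continuous_subtype_val.tendsto _).comp (hu.tendsto_mul_left ⟨d, hd'⟩),
      (continuous_subtype_val.tendsto _).comp (hu.tendsto_mul_right ⟨d, hd'⟩)⟩

/-- Almost orthogonal elements of a C*-algebra have small averages. -/
lemma CStarRing.norm_sum_range_sq_le (c : ℕ → A) {K δ : ℝ} (hK : ∀ i, ‖c i‖ ^ 2 ≤ K)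
    (hδ : ∀ i j, i ≠ j → ‖star (c i) * c j‖ ≤ δ) (hδ₀ : 0 ≤ δ) (N : ℕ) :
    ‖∑ i ∈ Finset.range N, c i‖ ^ 2 ≤ N * K + N ^ 2 * δ := by
  have h (i j : ℕ) : ‖star (c i) * c j‖ ≤ (if i = j then K else 0) + δ := by
    split_ifs with hij
    · subst hij
      rw [CStarRing.norm_star_mul_self, ← sq]
      linarith [hK i]
    · simpa using hδ i j hij
  calc ‖∑ i ∈ Finset.range N, c i‖ ^ 2
      = ‖∑ i ∈ Finset.range N, ∑ j ∈ Finset.range N, star (c i) * c j‖ := by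
        rw [sq, ← CStarRing.norm_star_mul_self, star_sum, Finset.sum_mul_sum]
    _ ≤ ∑ i ∈ Finset.range N, ∑ j ∈ Finset.range N, ((if i = j then K else 0) + δ) :=
        norm_sum_le_of_le _ fun i _ ↦ norm_sum_le_of_le _ fun j _ ↦ h i j
    _ = ∑ i ∈ Finset.range N, (K + N * δ) := by
        refine Finset.sum_congr rfl fun i hi ↦ ?_
        rw [Finset.sum_add_distrib, Finset.sum_ite_eq, if_pos hi]
        simp
    _ = N * K + N ^ 2 * δ := by
        simp
        ring

/-- The kernel of a *-homomorphism of C*-algebras has elements that are approximately central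
and act approximately as a left unit on a given element. -/
lemma NonUnitalStarAlgHom.exists_quasicentral_ker (φ : A →⋆ₙₐ[ℂ] B) (F : Finset A) (d : A)
    (hd : φ d = 0) {ε : ℝ} (hε : 0 < ε) :
    ∃ e, φ e = 0 ∧ (∀ z, ‖z - e * z‖ ≤ ‖z‖) ∧ ‖d - e * d‖ ≤ ε ∧
      ∀ x ∈ F, ‖e * x - x * e‖ < ε := by
  obtain ⟨l, _, hl, hlim⟩ := φ.exists_approximateUnit_ker
  let c (x e : A) : A := e * x - x * e
  have hc (x e : A) (he : φ e = 0) : φ (star (c x e)) = 0 := by rw [map_star]; simp [c, he]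
  have hδ : 0 < ε ^ 2 / 2 := by positivity
  obtain ⟨f, hf, hr⟩ := exists_seq_of_forall_finset_exists
    (fun e ↦ φ e = 0 ∧ ‖e‖ ≤ 1 ∧ (∀ z, ‖z - e * z‖ ≤ ‖z‖) ∧ ‖d - e * d‖ < ε)
    (fun e e' ↦ ∀ x ∈ F, ‖star (c x e) * c x e'‖ < ε ^ 2 / 2) (by
      intro s hs
      have h₁ : ∀ᶠ e in l, ‖d - e * d‖ < ε := by
        have := (tendsto_const_nhds (x := d)).sub (hlim d hd).2
        rw [sub_self] at this
        exact this.norm.eventually_lt_const (by simpa using hε)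
      have h₂ : ∀ᶠ e' in l, ∀ e ∈ s, ∀ x ∈ F, ‖star (c x e) * c x e'‖ < ε ^ 2 / 2 := by
        rw [eventually_all_finset]
        intro e he
        rw [eventually_all_finset]
        intro x _
        have he₀ := hc x e (hs e he).1
        have := ((hlim _ he₀).1.mul_const x).sub
          (hlim (star (c x e) * x) (by rw [map_mul, he₀, zero_mul])).1
        rw [sub_self] at this
        refine (this.norm.eventually_lt_const (u := ε ^ 2 / 2)
          (by simpa using hδ)).mono fun e' he' ↦ ?_
        simpa [c, mul_sub, mul_assoc] using he'
      obtain ⟨e, ⟨h₀, h₁', h₂'⟩, h₁, h₂⟩ := (hl.and (h₁.and h₂)).exists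
      exact ⟨e, ⟨h₀, h₁', h₂', h₁⟩, h₂⟩)
  have hr' (x : A) (hx : x ∈ F) (i j : ℕ) (hij : i ≠ j) :
      ‖star (c x (f i)) * c x (f j)‖ ≤ ε ^ 2 / 2 := by
    rcases hij.lt_or_gt with h | h
    · exact (hr i j h x hx).le
    · rw [← norm_star, star_mul, star_star]
      exact (hr j i h x hx).le
  have hN : ∀ᶠ N : ℕ in atTop, ∀ x ∈ F, (2 * ‖x‖) ^ 2 / N < ε ^ 2 / 2 := by
    rw [eventually_all_finset]
    exact fun x _ ↦ (tendsto_const_div_atTop_nhds_zero_nat _).eventually_lt_const hδ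
  obtain ⟨N, hN, hN₀⟩ := (hN.and (eventually_gt_atTop 0)).exists
  have hN₀' : (0 : ℝ) < N := by exact_mod_cast hN₀
  have hNC : (N : ℂ) ≠ 0 := by exact_mod_cast hN₀.ne'
  have hnorm (a : A) : ‖(N : ℂ)⁻¹ • a‖ = (N : ℝ)⁻¹ * ‖a‖ := by
    rw [norm_smul, norm_inv, Complex.norm_natCast]
  have havg (z : A) : z - ((N : ℂ)⁻¹ • ∑ i ∈ Finset.range N, f i) * z =
      (N : ℂ)⁻¹ • ∑ i ∈ Finset.range N, (z - f i * z) := by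
    rw [Finset.sum_sub_distrib, smul_sub, smul_mul_assoc, Finset.sum_mul]
    simp [← Nat.cast_smul_eq_nsmul ℂ, smul_smul, hNC]
  have havg_le (z : A) {K : ℝ} (h : ∀ i, ‖z - f i * z‖ ≤ K) :
      ‖z - ((N : ℂ)⁻¹ • ∑ i ∈ Finset.range N, f i) * z‖ ≤ K := by
    rw [havg, hnorm, inv_mul_le_iff₀ hN₀']
    simpa using norm_sum_le_of_le (Finset.range N) fun i _ ↦ h i
  refine ⟨(N : ℂ)⁻¹ • ∑ i ∈ Finset.range N, f i, ?_, fun z ↦ havg_le z fun i ↦ (hf i).2.2.1 z,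
    havg_le d fun i ↦ (hf i).2.2.2.le, fun x hx ↦ ?_⟩
  · rw [map_smul, map_sum, Finset.sum_eq_zero fun i _ ↦ (hf i).1, smul_zero]
  · have hcomm : ((N : ℂ)⁻¹ • ∑ i ∈ Finset.range N, f i) * x -
        x * ((N : ℂ)⁻¹ • ∑ i ∈ Finset.range N, f i) =
        (N : ℂ)⁻¹ • ∑ i ∈ Finset.range N, c x (f i) := by
      rw [Finset.sum_sub_distrib, smul_sub, smul_mul_assoc, mul_smul_comm, Finset.sum_mul,
        Finset.mul_sum]
    have hcx (i : ℕ) : ‖c x (f i)‖ ^ 2 ≤ (2 * ‖x‖) ^ 2 := by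
      gcongr
      calc ‖c x (f i)‖ ≤ ‖f i‖ * ‖x‖ + ‖x‖ * ‖f i‖ :=
            (norm_sub_le _ _).trans (add_le_add (norm_mul_le _ _) (norm_mul_le _ _))
        _ ≤ 2 * ‖x‖ := by nlinarith [(hf i).2.1, norm_nonneg x]
    have hsum := CStarRing.norm_sum_range_sq_le (fun i ↦ c x (f i)) hcx (hr' x hx) hδ.le N
    rw [hcomm, hnorm]
    refine lt_of_pow_lt_pow_left₀ 2 hε.le ?_
    have hNx := hN x hx
    calc ((N : ℝ)⁻¹ * ‖∑ i ∈ Finset.range N, c x (f i)‖) ^ 2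
        = ‖∑ i ∈ Finset.range N, c x (f i)‖ ^ 2 / N ^ 2 := by field_simp
      _ ≤ (N * (2 * ‖x‖) ^ 2 + N ^ 2 * (ε ^ 2 / 2)) / N ^ 2 := by gcongr
      _ = (2 * ‖x‖) ^ 2 / N + ε ^ 2 / 2 := by field_simp
      _ < ε ^ 2 := by linarith

open CStarAlgebra in
/-- Modulo the kernel of a *-homomorphism `φ` of C*-algebras, an element `k` can be changed to have
norm at most any given positive bound for `‖φ k‖`. -/
lemma NonUnitalStarAlgHom.exists_ker_norm_sub_le (φ : A →⋆ₙₐ[ℂ] B) (k : A) {r : ℝ} (hr : 0 < r)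
    (hk : ‖φ k‖ ≤ r) : ∃ d, φ d = 0 ∧ ‖k - d‖ ≤ r := by
  let g (t : ℝ) : ℝ := 1 - r / √(max |t| (r ^ 2))
  have hpos (t : ℝ) : 0 < max |t| (r ^ 2) := lt_max_of_lt_right (by positivity)
  have hg : Continuous g := by
    have (t : ℝ) : √(max |t| (r ^ 2)) ≠ 0 := (Real.sqrt_pos.2 (hpos t)).ne'
    fun_prop (disch := assumption)
  have hg_zero (t : ℝ) (ht : |t| ≤ r ^ 2) : g t = 0 := by
    simp [g, max_eq_right ht, Real.sqrt_sq hr.le, hr.ne']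
  have hg₀ : g 0 = 0 := hg_zero 0 (by simpa using sq_nonneg r)
  have hφ : Continuous φ := map_continuous φ
  have ha : IsSelfAdjoint (star k * k) := .star_mul_self k
  have hb : IsSelfAdjoint (star (φ k) * φ k) := .star_mul_self _
  let G : A := cfcₙ g (star k * k)
  have hG : star G = G := (cfcₙ_predicate g (star k * k)).star_eq
  refine ⟨k * G, ?_, ?_⟩
  · have hφG : φ G = cfcₙ g (star (φ k) * φ k) := by
      rw [← map_star, ← map_mul] at hb ⊢
      exact φ.map_cfcₙ g (star k * k) hg.continuousOn hg₀ hφ ha hb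
    have : cfcₙ g (star (φ k) * φ k) = 0 := by
      rw [← cfcₙ_zero ℝ (star (φ k) * φ k)]
      refine cfcₙ_congr fun t ht ↦ hg_zero t ?_
      have := norm_apply_le_norm_cfcₙ (id : ℝ → ℝ) (star (φ k) * φ k) ht
      rw [cfcₙ_id ℝ _ hb, CStarRing.norm_star_mul_self, ← sq] at this
      exact this.trans (by gcongr)
    rw [map_mul, hφG, this, mul_zero]
  · have hexp : star (k - k * G) * (k - k * G) =
        cfcₙ (fun t ↦ (t - g t * t) - (t - g t * t) * g t) (star k * k) := by
      rw [cfcₙ_sub (fun t ↦ t - g t * t) (fun t ↦ (t - g t * t) * g t) (star k * k)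
          (by fun_prop) (by simp) (by fun_prop) (by simp),
        cfcₙ_mul (fun t ↦ t - g t * t) g (star k * k) (by fun_prop) (by simp) (by fun_prop) hg₀,
        cfcₙ_sub (fun t ↦ t) (fun t ↦ g t * t) (star k * k) (by fun_prop) (by simp) (by fun_prop)
          (by simp),
        cfcₙ_mul g (fun t ↦ t) (star k * k) (by fun_prop) hg₀ (by fun_prop) (by simp),
        cfcₙ_id' ℝ (star k * k) ha]
      change _ = (star k * k - G * (star k * k)) - (star k * k - G * (star k * k)) * G
      rw [star_sub, star_mul, hG]
      noncomm_ring
    refine le_of_sq_le_sq ?_ hr.le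
    rw [sq, ← CStarRing.norm_star_mul_self, hexp]
    refine norm_cfcₙ_le fun t _ ↦ ?_
    have hmul : (t - g t * t) - (t - g t * t) * g t = t * (r ^ 2 / max |t| (r ^ 2)) := by
      have : (r / √(max |t| (r ^ 2))) ^ 2 = r ^ 2 / max |t| (r ^ 2) := by
        rw [div_pow, Real.sq_sqrt (hpos t).le]
      rw [← this]
      simp only [g]
      ring
    rw [hmul, Real.norm_eq_abs, abs_mul, abs_of_nonneg (div_nonneg (sq_nonneg r) (hpos t).le),
      mul_div_assoc', div_le_iff₀ (hpos t), mul_comm]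
    gcongr
    exact le_max_left _ _

/-- Modulo the kernel of a *-homomorphism `φ` of C*-algebras, a sum `k` of commutators can be
changed to a sum of commutators of norm smaller than any given strict bound for `‖φ k‖`. -/
lemma NonUnitalStarAlgHom.exists_mem_span_commutator_norm_lt (φ : A →⋆ₙₐ[ℂ] B) {k : A}
    (hk : k ∈ Submodule.span ℂ {z : A | ∃ x y : A, z = x * y - y * x}) {R : ℝ}
    (hR : ‖φ k‖ < R) :
    ∃ s ∈ Submodule.span ℂ {z : A | ∃ x y : A, z = x * y - y * x}, φ s = φ k ∧ ‖s‖ < R := by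
  classical
  obtain ⟨r, hkr, hrR⟩ := exists_between hR
  obtain ⟨d, hd, hkd⟩ :=
    φ.exists_ker_norm_sub_le k ((norm_nonneg _).trans_lt hkr) hkr.le
  obtain ⟨n, c, w, rfl⟩ := Submodule.mem_span_set'.1 hk
  choose x y hw using fun i ↦ (w i).2
  set M : ℝ := ∑ i, ‖c i‖ * ‖x i‖
  have hM : 0 ≤ M := by positivity
  obtain ⟨ε, hε, hεR⟩ : ∃ ε > 0, r + ε + M * ε < R := by
    refine ⟨(R - r) / (2 * (1 + M)), div_pos (by linarith) (by positivity), ?_⟩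
    have : (R - r) / (2 * (1 + M)) * (1 + M) = (R - r) / 2 := by field_simp
    linarith
  obtain ⟨e, he, hez, hed, hey⟩ := φ.exists_quasicentral_ker (Finset.univ.image y) d hd hε
  set k : A := ∑ i, c i • (w i : A)
  have hsk : ∑ i, c i • ((x i - e * x i) * y i - y i * (x i - e * x i)) =
      (k - e * k) - ∑ i, c i • ((e * y i - y i * e) * x i) := by
    rw [Finset.mul_sum, ← Finset.sum_sub_distrib, ← Finset.sum_sub_distrib]
    refine Finset.sum_congr rfl fun i _ ↦ ?_
    rw [hw, mul_smul_comm, ← smul_sub, ← smul_sub]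
    congr 1
    noncomm_ring
  refine ⟨∑ i, c i • ((x i - e * x i) * y i - y i * (x i - e * x i)),
    Submodule.sum_mem _ fun i _ ↦ Submodule.smul_mem _ (c i)
    (Submodule.subset_span ⟨x i - e * x i, y i, rfl⟩), ?_, ?_⟩
  · simp [k, hw, he]
  · rw [hsk]
    have h₁ : ‖k - e * k‖ ≤ r + ε := by
      have : k - e * k = ((k - d) - e * (k - d)) + (d - e * d) := by noncomm_ring
      rw [this]
      exact (norm_add_le _ _).trans (add_le_add ((hez _).trans hkd) hed)
    have h₂ : ‖∑ i, c i • ((e * y i - y i * e) * x i)‖ ≤ M * ε := by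
      rw [Finset.sum_mul]
      refine norm_sum_le_of_le _ fun i _ ↦ ?_
      rw [norm_smul, mul_assoc, mul_comm ‖x i‖]
      gcongr
      refine (norm_mul_le _ _).trans ?_
      gcongr
      exact (hey _ (Finset.mem_image_of_mem y (Finset.mem_univ i))).le
    linarith [norm_sub_le (k - e * k) (∑ i, c i • ((e * y i - y i * e) * x i))]

/-- A surjective *-homomorphism maps the span of commutators onto the span of commutators. -/
lemma NonUnitalStarAlgHom.exists_mem_span_commutator_map_eq (φ : A →⋆ₙₐ[ℂ] B)
    (hφ : Function.Surjective φ) {b : B}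
    (hb : b ∈ Submodule.span ℂ {z : B | ∃ x y : B, z = x * y - y * x}) :
    ∃ a ∈ Submodule.span ℂ {z : A | ∃ x y : A, z = x * y - y * x}, φ a = b := by
  induction hb using Submodule.span_induction with
  | mem b hb =>
    obtain ⟨x, y, rfl⟩ := hb
    obtain ⟨x, rfl⟩ := hφ x
    obtain ⟨y, rfl⟩ := hφ y
    exact ⟨x * y - y * x, Submodule.subset_span ⟨x, y, rfl⟩, by simp⟩
  | zero => exact ⟨0, Submodule.zero_mem _, map_zero φ⟩
  | add b₁ b₂ _ _ h₁ h₂ =>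
    obtain ⟨a₁, ha₁, rfl⟩ := h₁
    obtain ⟨a₂, ha₂, rfl⟩ := h₂
    exact ⟨a₁ + a₂, Submodule.add_mem _ ha₁ ha₂, map_add φ a₁ a₂⟩
  | smul c b _ h =>
    obtain ⟨a, ha, rfl⟩ := h
    exact ⟨c • a, Submodule.smul_mem _ c ha, map_smul φ c a⟩

end StarHom

/-- If a C*-algebra `A` has commutator bounds `(m, C)` and `I` is a
closed two-sided ideal of `A`, then the quotient C*-algebra `A/I` has commutator
bounds `(m, C)`.  The quotient `A/I` is represented (uniquely, up to isometric
*-isomorphism) as a C*-algebra `B` together with a surjective *-homomorphism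
`φ : A → B` whose kernel is `I`. -/
theorem statement5 {A B : Type*} [NonUnitalCStarAlgebra A] [NonUnitalCStarAlgebra B]
    (m : ℕ) (C : ℝ) (hA : HasCommutatorBounds A m C)
    (I : TwoSidedIdeal A) (hI : IsClosed (I : Set A))
    (φ : A →⋆ₙₐ[ℂ] B) (hsurj : Function.Surjective φ)
    (hker : ∀ a : A, φ a = 0 ↔ a ∈ I) :
    HasCommutatorBounds B m C := by
  intro h hh ε hε
  rcases eq_or_ne h 0 with rfl | h₀
  · exact ⟨0, 0, by simpa using hε, by simp⟩
  have hr : 0 < ‖h‖ := norm_pos_iff.2 h₀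
  obtain ⟨δ, hδ, hδε, hδr⟩ : ∃ δ > 0, δ ≤ ε / 4 ∧ δ ≤ ‖h‖ :=
    ⟨min (ε / 4) ‖h‖, by positivity, min_le_left _ _, min_le_right _ _⟩
  obtain ⟨b, hb, hhb⟩ := Metric.mem_closure_iff.1 hh δ hδ
  rw [dist_eq_norm] at hhb
  obtain ⟨k, hk, rfl⟩ := φ.exists_mem_span_commutator_map_eq hsurj hb
  have hkR : ‖φ k‖ < ‖h‖ + δ := by
    have := norm_sub_norm_le (φ k) h
    rw [norm_sub_rev] at this
    linarith
  obtain ⟨s, hs, hsk, hsR⟩ := φ.exists_mem_span_commutator_norm_lt hk hkR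
  have hR : 0 < ‖h‖ + δ := by positivity
  let t : ℝ := ‖h‖ / (‖h‖ + δ)
  have ht₀ : 0 < t := by positivity
  have htR : t * (‖h‖ + δ) = ‖h‖ := div_mul_cancel₀ _ hR.ne'
  have ht₁ : t ≤ 1 := (div_le_one hR).2 (by linarith)
  have hts : ‖(t : ℂ) • s‖ = t * ‖s‖ := by
    rw [norm_smul, Complex.norm_real, Real.norm_of_nonneg ht₀.le]
  obtain ⟨x, y, hxy, hC⟩ := hA _ (subset_closure (Submodule.smul_mem _ (t : ℂ) hs)) (ε / 2)
    (by positivity)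
  have hφ_le (a : A) : ‖φ a‖ ≤ ‖a‖ := NonUnitalStarAlgHom.norm_apply_le φ a
  refine ⟨fun i ↦ φ (x i), fun i ↦ φ (y i), ?_, ?_⟩
  · have h₁ : ‖φ k - φ ((t : ℂ) • s)‖ ≤ δ := by
      have : φ k - φ ((t : ℂ) • s) = ((1 - t : ℝ) : ℂ) • φ k := by
        rw [map_smul, hsk, Complex.ofReal_sub, Complex.ofReal_one, sub_smul, one_smul]
      rw [this, norm_smul, Complex.norm_real, Real.norm_of_nonneg (by linarith)]
      nlinarith
    have h₂ := (hφ_le _).trans_lt hxy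
    simp only [map_sub, map_sum, map_mul] at h₂
    have h₃ := norm_sub_le_norm_sub_add_norm_sub h (φ k)
      (∑ i, (φ (x i) * φ (y i) - φ (y i) * φ (x i)))
    have h₄ := norm_sub_le_norm_sub_add_norm_sub (φ k) (φ ((t : ℂ) • s))
      (∑ i, (φ (x i) * φ (y i) - φ (y i) * φ (x i)))
    linarith
  · have hs₀ : 0 < ‖s‖ := by
      refine norm_pos_iff.2 fun hs₀ ↦ ?_
      rw [← hsk, hs₀, map_zero, sub_zero] at hhb
      linarith
    have hC₀ : 0 ≤ C := by
      refine nonneg_of_mul_nonneg_left (b := ‖(t : ℂ) • s‖) ?_ (by rw [hts]; positivity)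
      exact le_trans (by positivity) hC
    calc ∑ i, ‖φ (x i)‖ * ‖φ (y i)‖ ≤ ∑ i, ‖x i‖ * ‖y i‖ := by
          gcongr <;> exact hφ_le _
      _ ≤ C * ‖(t : ℂ) • s‖ := hC
      _ ≤ C * ‖h‖ := by
          gcongr
          rw [hts, ← htR]
          gcongr
end

section
/- Let A be a C*-algebra and let (A_λ)_{λ∈Λ} be a family of C*-subalgebras of A that is directed under inclusion (for any λ, μ there is ν with A_λ ∪ A_μ ⊆ A_ν) and whose union is dense in A. If every A_λ has commutator bounds (m, C), then A has commutator bounds (m, C). -/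
/-- If a family of subalgebras is directed and has dense union, then every limit of sums of
commutators is a limit of sums of commutators taken within one member of the family. -/
theorem exists_norm_sub_lt_of_mem_closure_span_commutators {A : Type*} [NonUnitalCStarAlgebra A]
    {Λ : Type*} (S : Λ → NonUnitalStarSubalgebra ℂ A)
    (hdir : ∀ l₁ l₂ : Λ, ∃ l₃, S l₁ ≤ S l₃ ∧ S l₂ ≤ S l₃)
    (hdense : Dense (⋃ l, (S l : Set A))) {h : A}
    (hh : h ∈ closure (Submodule.span ℂ {z : A | ∃ x y : A, z = x * y - y * x} : Set A))
    {δ : ℝ} (hδ : 0 < δ) :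
    ∃ l, ∃ k ∈ Submodule.span ℂ {z : A | ∃ x ∈ S l, ∃ y ∈ S l, z = x * y - y * x},
      ‖h - k‖ < δ := by
  set K : Λ → Submodule ℂ A := fun l =>
    Submodule.span ℂ {z : A | ∃ x ∈ S l, ∃ y ∈ S l, z = x * y - y * x}
  have hmono : ∀ l₁ l₂, S l₁ ≤ S l₂ → K l₁ ≤ K l₂ := by
    intro l₁ l₂ hle
    refine Submodule.span_mono ?_
    rintro z ⟨x, hx, y, hy, rfl⟩
    exact ⟨x, hle hx, y, hle hy, rfl⟩
  have hdirK : Directed (· ≤ ·) K := fun l₁ l₂ =>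
    let ⟨l₃, h₁, h₂⟩ := hdir l₁ l₂
    ⟨l₃, hmono _ _ h₁, hmono _ _ h₂⟩
  have hne : Nonempty Λ := by
    obtain ⟨a, ha⟩ := hdense.nonempty
    exact ⟨(Set.mem_iUnion.1 ha).choose⟩
  have hspan : Submodule.span ℂ {z : A | ∃ x y : A, z = x * y - y * x} ≤
      (⨆ l, K l).topologicalClosure := by
    refine Submodule.span_le.2 ?_
    rintro z ⟨x, y, rfl⟩
    have hcont : Continuous (Function.uncurry fun x y : A => x * y - y * x) := by
      simp only [Function.uncurry_def]
      fun_prop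
    refine map_mem_closure₂ (f := fun x y : A => x * y - y * x) hcont (hdense x) (hdense y)
      fun a ha b hb => ?_
    obtain ⟨l₁, ha⟩ := Set.mem_iUnion.1 ha
    obtain ⟨l₂, hb⟩ := Set.mem_iUnion.1 hb
    obtain ⟨l₃, h₁, h₂⟩ := hdir l₁ l₂
    exact Submodule.mem_iSup_of_mem l₃ (Submodule.subset_span ⟨a, h₁ ha, b, h₂ hb, rfl⟩)
  have hmem : h ∈ closure ((⨆ l, K l : Submodule ℂ A) : Set A) :=
    closure_minimal hspan (Submodule.isClosed_topologicalClosure _) hh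
  obtain ⟨k, hk, hlt⟩ := Metric.mem_closure_iff.1 hmem δ hδ
  obtain ⟨l, hl⟩ := (Submodule.mem_iSup_of_directed K hdirK).1 hk
  exact ⟨l, k, hl, by rwa [← dist_eq_norm]⟩

/-- Rescaling `k` to the norm of `h` at most doubles its distance to `h`. -/
theorem exists_smul_norm_eq_and_norm_sub_le {E : Type*} [NormedAddCommGroup E] [NormedSpace ℂ E]
    (h k : E) (hk : k ≠ 0) : ∃ c : ℂ, ‖c • k‖ = ‖h‖ ∧ ‖h - c • k‖ ≤ 2 * ‖h - k‖ := by
  have hk' : ‖k‖ ≠ 0 := norm_ne_zero_iff.2 hk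
  refine ⟨((‖h‖ / ‖k‖ : ℝ) : ℂ), ?_, ?_⟩
  · rw [norm_smul, Complex.norm_real, Real.norm_of_nonneg (by positivity),
      div_mul_cancel₀ _ hk']
  · have hscale : ‖k - ((‖h‖ / ‖k‖ : ℝ) : ℂ) • k‖ = |‖k‖ - ‖h‖| := by
      have : k - ((‖h‖ / ‖k‖ : ℝ) : ℂ) • k = ((1 - ‖h‖ / ‖k‖ : ℝ) : ℂ) • k := by
        push_cast
        rw [sub_smul, one_smul]
      rw [this, norm_smul, Complex.norm_real, Real.norm_eq_abs, ← abs_norm k, ← abs_mul,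
        abs_norm, sub_mul, one_mul, div_mul_cancel₀ _ hk']
    have habs : |‖k‖ - ‖h‖| ≤ ‖h - k‖ := norm_sub_rev k h ▸ abs_norm_sub_norm_le k h
    have htri := norm_sub_le_norm_sub_add_norm_sub h k (((‖h‖ / ‖k‖ : ℝ) : ℂ) • k)
    linarith

/-- Let `A` be a C*-algebra and `(A_λ)_{λ∈Λ}` a family of (closed)
C*-subalgebras that is directed under inclusion and has dense union.  If every `A_λ`
has commutator bounds `(m, C)` (stated intrinsically: commutators of elements of
`A_λ` and witnesses in `A_λ`; note that the norm closure computed in `A` of a subset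
of the closed set `A_λ` agrees with the closure computed in `A_λ`), then `A` has
commutator bounds `(m, C)`. -/
theorem statement7 {A : Type*} [NonUnitalCStarAlgebra A] {Λ : Type*}
    (S : Λ → NonUnitalStarSubalgebra ℂ A)
    (hclosed : ∀ l, IsClosed (S l : Set A))
    (hdir : ∀ l₁ l₂ : Λ, ∃ l₃, S l₁ ≤ S l₃ ∧ S l₂ ≤ S l₃)
    (hdense : Dense (⋃ l, (S l : Set A)))
    (m : ℕ) (C : ℝ)
    (hbounds : ∀ l : Λ,
      ∀ h ∈ closure
        (Submodule.span ℂ {z : A | ∃ x ∈ S l, ∃ y ∈ S l, z = x * y - y * x} : Set A),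
        ∀ ε > 0, ∃ x y : Fin m → A,
          (∀ i, x i ∈ S l ∧ y i ∈ S l) ∧
          ‖h - ∑ i, (x i * y i - y i * x i)‖ < ε ∧
          ∑ i, ‖x i‖ * ‖y i‖ ≤ C * ‖h‖) :
    HasCommutatorBounds A m C := by
  intro h hh ε hε
  rcases eq_or_ne h 0 with rfl | h0
  · exact ⟨0, 0, by simpa using hε, by simp⟩
  have hpos : 0 < ‖h‖ := norm_pos_iff.2 h0
  obtain ⟨l, k, hk, hlt⟩ := exists_norm_sub_lt_of_mem_closure_span_commutators S hdir hdense hh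
    (lt_min hpos (by positivity : 0 < ε / 4))
  have hk0 : k ≠ 0 := by
    rintro rfl
    simp at hlt
  obtain ⟨c, hnorm, hdist⟩ := exists_smul_norm_eq_and_norm_sub_le h k hk0
  obtain ⟨x, y, -, hxy, hC⟩ := hbounds l (c • k)
    (subset_closure (Submodule.smul_mem _ c hk)) (ε / 2) (by positivity)
  refine ⟨x, y, ?_, hnorm ▸ hC⟩
  have htri := norm_sub_le_norm_sub_add_norm_sub h (c • k) (∑ i, (x i * y i - y i * x i))
  have := hlt.trans_le (min_le_right _ _)
  linarith
end

section
/- Let A be a C*-algebra and let z ∈ A satisfy z² = 0. Then there exist u, v ∈ A with z = uv − vu, and there exists w ∈ A with z + z* = w*w − ww*. -/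
theorem CStarMatrix.ofMatrix_fun_apply {m n A : Type*} (f : m → n → A) (i : m) (j : n) :
    CStarMatrix.ofMatrix (fun i j ↦ f i j) i j = f i j := rfl

/-- The grading automorphism of `2 × 2` matrices, changing the sign of the off-diagonal entries. -/
def CStarMatrix.gradingHom (A : Type*) [NonUnitalCStarAlgebra A] :
    CStarMatrix (Fin 2) (Fin 2) A →⋆ₙₐ[ℂ] CStarMatrix (Fin 2) (Fin 2) A where
  toFun M := CStarMatrix.ofMatrix fun i j ↦ if i = j then M i j else -M i j
  map_smul' c M := by
    ext i j
    by_cases h : i = j <;> simp [CStarMatrix.ofMatrix_fun_apply, h]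
  map_zero' := by
    ext i j
    simp [CStarMatrix.ofMatrix_fun_apply]
  map_add' M N := by
    ext i j
    by_cases h : i = j <;> simp [CStarMatrix.ofMatrix_fun_apply, h, add_comm]
  map_mul' M N := by
    ext i j
    fin_cases i <;> fin_cases j <;> simp [CStarMatrix.ofMatrix_fun_apply, CStarMatrix.mul_apply, add_comm]
  map_star' M := by
    ext i j
    fin_cases i <;> fin_cases j <;> simp [CStarMatrix.ofMatrix_fun_apply, CStarMatrix.star_apply]

theorem CStarMatrix.gradingHom_apply {A : Type*} [NonUnitalCStarAlgebra A]
    (M : CStarMatrix (Fin 2) (Fin 2) A) (i j : Fin 2) :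
    CStarMatrix.gradingHom A M i j = if i = j then M i j else -M i j := rfl

open scoped CStarAlgebra in
/-- A self-adjoint `h` which is odd for a grading `φ` factors through the odd element
`sign(h)|h|^(1/2)` and the even element `|h|^(1/2)`. -/
theorem IsSelfAdjoint.exists_odd_even_sqrt {B : Type*} [NonUnitalCStarAlgebra B] {h : B}
    (hh : IsSelfAdjoint h) (φ : B →⋆ₙₐ[ℂ] B) (hφ : φ h = -h) :
    ∃ g k : B, IsSelfAdjoint g ∧ IsSelfAdjoint k ∧ φ g = -g ∧ φ k = k ∧ g * g = k * k ∧
      g * k = h ∧ k * g = h := by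
  let f : ℝ → ℝ := fun t ↦ √t - √(-t)
  let e : ℝ → ℝ := fun t ↦ √t + √(-t)
  have hf : Continuous f := by fun_prop
  have he : Continuous e := by fun_prop
  have hf0 : f 0 = 0 := by simp [f]
  have he0 : e 0 = 0 := by simp [e]
  have hff (t : ℝ) : f t * f t = e t * e t := by
    rcases le_total 0 t with ht | ht
    · simp [f, e, Real.sqrt_eq_zero_of_nonpos (neg_nonpos.2 ht)]
    · simp [f, e, Real.sqrt_eq_zero_of_nonpos ht]
  have hfe (t : ℝ) : f t * e t = t := by
    rcases le_total 0 t with ht | ht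
    · simp [f, e, Real.sqrt_eq_zero_of_nonpos (neg_nonpos.2 ht), Real.mul_self_sqrt ht]
    · simp [f, e, Real.sqrt_eq_zero_of_nonpos ht, Real.mul_self_sqrt (neg_nonneg.2 ht)]
  have hprod : cfcₙ f h * cfcₙ e h = h := by
    rw [← cfcₙ_mul f e h]
    simp only [hfe]
    exact cfcₙ_id' ℝ h
  have hcont : Continuous φ := map_continuous φ
  refine ⟨cfcₙ f h, cfcₙ e h, cfcₙ_predicate f h, cfcₙ_predicate e h, ?_, ?_, ?_, hprod, ?_⟩
  · rw [NonUnitalStarAlgHom.map_cfcₙ φ f h (hφa := hφ ▸ hh.neg), hφ,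
      ← cfcₙ_comp_neg f h, ← cfcₙ_neg f h]
    simp [f]
  · rw [NonUnitalStarAlgHom.map_cfcₙ φ e h (hφa := hφ ▸ hh.neg), hφ, ← cfcₙ_comp_neg e h]
    simp [e, add_comm]
  · rw [← cfcₙ_mul f f h, ← cfcₙ_mul e e h]
    simp only [hff]
  · exact (cfcₙ_commute_cfcₙ e f h).eq.trans hprod

/-- A form of the polar decomposition: with `z = v|z|` in the bidual, `y = v|z|^(1/2)`,
`q = |z|^(1/2)` and `p = |z*|^(1/2)` all lie in the algebra. -/
theorem exists_sqrt_polar {A : Type*} [NonUnitalCStarAlgebra A] (z : A) :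
    ∃ y q p : A, IsSelfAdjoint q ∧ IsSelfAdjoint p ∧ q * q = star y * y ∧ p * p = y * star y ∧
      y * q = z ∧ p * y = z := by
  let : PartialOrder A := CStarAlgebra.spectralOrder A
  have : StarOrderedRing A := CStarAlgebra.spectralOrderedRing A
  have : IsAddTorsionFree A := .of_isTorsionFree ℂ A
  let H : CStarMatrix (Fin 2) (Fin 2) A := CStarMatrix.ofMatrix !![0, star z; z, 0]
  have hH : IsSelfAdjoint H := by
    ext i j
    fin_cases i <;> fin_cases j <;> simp [H, CStarMatrix.star_apply]
  have hφH : CStarMatrix.gradingHom A H = -H := by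
    ext i j
    fin_cases i <;> fin_cases j <;>
      simp [H, CStarMatrix.gradingHom_apply]
  obtain ⟨G, K, hG, hK, hφG, hφK, hGG, hGK, hKG⟩ := hH.exists_odd_even_sqrt _ hφH
  have hGd (i : Fin 2) : G i i = 0 := by
    have h := CStarMatrix.ext_iff.2 hφG i i
    rw [CStarMatrix.gradingHom_apply, if_pos rfl, CStarMatrix.neg_apply] at h
    exact self_eq_neg.1 h
  have hKd (i j : Fin 2) (hij : i ≠ j) : K i j = 0 := by
    have h := CStarMatrix.ext_iff.2 hφK i j
    rw [CStarMatrix.gradingHom_apply, if_neg hij] at h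
    exact self_eq_neg.1 h.symm
  have hGs : G 0 1 = star (G 1 0) := by
    rw [CStarMatrix.star_apply_of_isSelfAdjoint hG]
  refine ⟨G 1 0, K 0 0, K 1 1, ?_, ?_, ?_, ?_, ?_, ?_⟩
  · exact CStarMatrix.star_apply_of_isSelfAdjoint hK
  · exact CStarMatrix.star_apply_of_isSelfAdjoint hK
  · have h := CStarMatrix.ext_iff.2 hGG 0 0
    simpa [CStarMatrix.mul_apply, hGd, hKd, hGs] using h.symm
  · have h := CStarMatrix.ext_iff.2 hGG 1 1
    simpa [CStarMatrix.mul_apply, hGd, hKd, hGs] using h.symm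
  · have h := CStarMatrix.ext_iff.2 hGK 1 0
    simpa [CStarMatrix.mul_apply, hGd, hKd, H] using h
  · have h := CStarMatrix.ext_iff.2 hKG 1 0
    simpa [CStarMatrix.mul_apply, hGd, hKd, H] using h

theorem IsSelfAdjoint.mul_eq_zero_of_mul_mul_eq_zero {A : Type*} [NonUnitalCStarAlgebra A]
    {a b : A} (ha : IsSelfAdjoint a) (h : a * (a * b) = 0) : a * b = 0 := by
  rw [← CStarRing.star_mul_self_eq_zero_iff, star_mul, ha.star_eq, mul_assoc, h, mul_zero]

/-- In a C*-algebra, a square-zero element `z` is a commutator,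
and `z + z*` is a self-commutator `w*w - ww*`. -/
theorem statement10 {A : Type*} [NonUnitalCStarAlgebra A] (z : A) (hz : z * z = 0) :
    (∃ u v : A, z = u * v - v * u) ∧ (∃ w : A, z + star z = star w * w - w * star w) := by
  obtain ⟨y, q, p, hq, hp, hqq, hpp, hyq, hpy⟩ := exists_sqrt_polar z
  have hqp : q * p = 0 := by
    have h : q * (q * (q * (p * p * p))) = 0 := by
      calc q * (q * (q * (p * p * p))) = (q * q) * (q * p) * (p * p) := by simp only [mul_assoc]
        _ = star y * ((y * q) * (p * y)) * star y := by rw [hqq, hpp]; simp only [mul_assoc]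
        _ = 0 := by rw [hyq, hpy, hz, mul_zero, zero_mul]
    have h' := hq.mul_eq_zero_of_mul_mul_eq_zero (hq.mul_eq_zero_of_mul_mul_eq_zero h)
    have h'' : p * (p * (p * q)) = 0 := by
      simpa [hq.star_eq, hp.star_eq, mul_assoc] using congrArg star h'
    simpa [hq.star_eq, hp.star_eq] using congrArg star
      (hp.mul_eq_zero_of_mul_mul_eq_zero (hp.mul_eq_zero_of_mul_mul_eq_zero h''))
  have hpq : p * q = 0 := by
    simpa [hq.star_eq, hp.star_eq] using congrArg star hqp
  have hqy : q * y = 0 := by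
    rw [← CStarRing.mul_star_self_eq_zero_iff, star_mul, hq.star_eq]
    calc q * y * (star y * q) = q * (y * star y) * q := by simp only [mul_assoc]
      _ = (q * p) * (p * q) := by rw [← hpp]; simp only [mul_assoc]
      _ = 0 := by rw [hqp, zero_mul]
  have hyp : y * p = 0 := by
    rw [← CStarRing.star_mul_self_eq_zero_iff, star_mul, hp.star_eq]
    calc p * star y * (y * p) = p * (star y * y) * p := by simp only [mul_assoc]
      _ = (p * q) * (q * p) := by rw [← hqq]; simp only [mul_assoc]
      _ = 0 := by rw [hpq, zero_mul]
  have hyy : y * y = 0 := by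
    rw [← CStarRing.star_mul_self_eq_zero_iff, star_mul]
    calc star y * star y * (y * y) = star y * (star y * y) * y := by simp only [mul_assoc]
      _ = star y * q * (q * y) := by rw [← hqq]; simp only [mul_assoc]
      _ = 0 := by rw [hqy, mul_zero]
  have hqy' : q * star y = star z := by rw [← hyq, star_mul, hq.star_eq]
  have hyp' : star y * p = star z := by rw [← hpy, star_mul, hp.star_eq]
  have hyq' : star y * q = 0 := by simpa [hq.star_eq] using congrArg star hqy
  have hpy' : p * star y = 0 := by simpa [hp.star_eq] using congrArg star hyp
  have hyy' : star y * star y = 0 := by simpa using congrArg star hyy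
  refine ⟨⟨y, q, by rw [hyq, hqy, sub_zero]⟩, (1 / 2 : ℂ) • (p + y - star y - q), ?_⟩
  have hc : (starRingEnd ℂ) (1 / 2) = 1 / 2 := by simp [map_ofNat]
  simp only [star_smul, star_sub, star_add, star_star, hp.star_eq, hq.star_eq, RCLike.star_def, hc,
    smul_mul_smul_comm, mul_add, mul_sub, add_mul, sub_mul, hqp, hpq, hqy, hyp, hyy, hqy', hyp',
    hyq', hpy', hyy', hyq, hpy, ← hqq, ← hpp]
  module
end

section
/- Let A be a C*-algebra and let a, b ∈ A be contractions (‖a‖ ≤ 1, ‖b‖ ≤ 1) with a² = 0 and b² = 0. Then the three elements n₁ = ab + aba − b − ba, n₂ = −aba, and n₃ = b satisfy n₁² = n₂² = n₃² = 0, [a,b] = n₁ + n₂ + n₃, and ‖n_i‖ ≤ 4 for i = 1, 2, 3. In particular, the commutator of two square-zero elements of a C*-algebra is a sum of three square-zero elements. -/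
/-- If `a, b` are square-zero contractions in a C*-algebra, then
`n₁ = ab + aba − b − ba`, `n₂ = −aba`, `n₃ = b` are square-zero, sum to `[a,b]`,
and each has norm at most `4`.  In particular the commutator of two square-zero
elements is a sum of three square-zero elements. -/
theorem statement11 {A : Type*} [NonUnitalCStarAlgebra A] (a b : A)
    (ha1 : ‖a‖ ≤ 1) (hb1 : ‖b‖ ≤ 1) (ha2 : a * a = 0) (hb2 : b * b = 0) :
    (a * b + a * b * a - b - b * a) * (a * b + a * b * a - b - b * a) = 0 ∧
    (-(a * b * a)) * (-(a * b * a)) = 0 ∧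
    b * b = 0 ∧
    a * b - b * a = (a * b + a * b * a - b - b * a) + (-(a * b * a)) + b ∧
    ‖a * b + a * b * a - b - b * a‖ ≤ 4 ∧ ‖-(a * b * a)‖ ≤ 4 ∧ ‖b‖ ≤ 4 := by
  have haa (x : A) : a * (a * x) = 0 := by rw [← mul_assoc, ha2, zero_mul]
  have hbb (x : A) : b * (b * x) = 0 := by rw [← mul_assoc, hb2, zero_mul]
  have hab : ‖a * b‖ ≤ 1 := (norm_mul_le a b).trans (mul_le_one₀ ha1 (norm_nonneg b) hb1)
  have hba : ‖b * a‖ ≤ 1 := (norm_mul_le b a).trans (mul_le_one₀ hb1 (norm_nonneg a) ha1)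
  have haba : ‖a * b * a‖ ≤ 1 :=
    (norm_mul_le (a * b) a).trans (mul_le_one₀ hab (norm_nonneg a) ha1)
  refine ⟨?_, ?_, hb2, ?_, ?_, ?_, ?_⟩
  · simp only [mul_add, add_mul, mul_sub, sub_mul, mul_assoc, hb2, haa, hbb, mul_zero]
    abel
  · simp only [neg_mul_neg, mul_assoc, haa, mul_zero]
  · abel
  · have h₁ := norm_sub_le (a * b + a * b * a - b) (b * a)
    have h₂ := norm_sub_le (a * b + a * b * a) b
    have h₃ := norm_add_le (a * b) (a * b * a)
    linarith
  · rw [norm_neg]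
    linarith
  · linarith
end

section
/- There exists a universal constant C > 0 such that for every C*-algebra B and all a, b ∈ M₂(B), the commutator [a,b] = ab − ba is a sum of at most 14 square-zero elements of M₂(B), each of norm at most C·‖a‖·‖b‖. -/
/-- The defining properties of a (not necessarily complete) C*-norm on `M₂(B)`. -/
structure IsMatrixCStarNorm {B : Type*} [NonUnitalCStarAlgebra B]
    (N : Matrix (Fin 2) (Fin 2) B → ℝ) : Prop where
  nonneg : ∀ X, 0 ≤ N X
  eq_zero_iff : ∀ X, N X = 0 ↔ X = 0
  add_le : ∀ X Y, N (X + Y) ≤ N X + N Y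
  smul : ∀ (c : ℂ) (X), N (c • X) = ‖c‖ * N X
  mul_le : ∀ X Y, N (X * Y) ≤ N X * N Y
  star_mul_self : ∀ X, N (X.conjTranspose * X) = N X * N X

namespace IsMatrixCStarNorm

open Matrix

variable {B : Type*} [NonUnitalCStarAlgebra B] {N : Matrix (Fin 2) (Fin 2) B → ℝ}

theorem zero (h : IsMatrixCStarNorm N) : N 0 = 0 := (h.eq_zero_iff 0).2 rfl

theorem neg (h : IsMatrixCStarNorm N) (X : Matrix (Fin 2) (Fin 2) B) : N (-X) = N X := by
  simpa using h.smul (-1) X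

theorem sub_le (h : IsMatrixCStarNorm N) (X Y : Matrix (Fin 2) (Fin 2) B) :
    N (X - Y) ≤ N X + N Y := by
  simpa [sub_eq_add_neg, h.neg] using h.add_le X (-Y)

theorem le_conjTranspose (h : IsMatrixCStarNorm N) (X : Matrix (Fin 2) (Fin 2) B) :
    N X ≤ N Xᴴ := by
  have h1 := h.mul_le Xᴴ X
  rw [h.star_mul_self] at h1
  rcases (h.nonneg X).eq_or_lt with h0 | h0
  · exact h0 ▸ h.nonneg _
  · exact le_of_mul_le_mul_right h1 h0

theorem conjTranspose (h : IsMatrixCStarNorm N) (X : Matrix (Fin 2) (Fin 2) B) :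
    N Xᴴ = N X :=
  le_antisymm (by simpa using h.le_conjTranspose Xᴴ) (h.le_conjTranspose X)

theorem mul_star_self (h : IsMatrixCStarNorm N) (X : Matrix (Fin 2) (Fin 2) B) :
    N (X * Xᴴ) = N X * N X := by
  simpa [h.conjTranspose] using h.star_mul_self Xᴴ

theorem eq_of_star_mul_self (h : IsMatrixCStarNorm N) {X Y : Matrix (Fin 2) (Fin 2) B}
    (hXY : Xᴴ * X = Yᴴ * Y) : N X = N Y := by
  have := h.star_mul_self X
  rw [hXY, h.star_mul_self] at this
  exact (mul_self_inj (h.nonneg _) (h.nonneg _)).1 this.symm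

theorem eq_of_mul_star_self (h : IsMatrixCStarNorm N) {X Y : Matrix (Fin 2) (Fin 2) B}
    (hXY : X * Xᴴ = Y * Yᴴ) : N X = N Y := by
  rw [← h.conjTranspose X, ← h.conjTranspose Y]
  exact h.eq_of_star_mul_self (by simpa using hXY)

theorem single_eq (h : IsMatrixCStarNorm N) (i j : Fin 2) (x : B) :
    N (single i j x) = N (single 0 0 x) :=
  (h.eq_of_star_mul_self (Y := single 0 j x) (by simp [conjTranspose_single])).trans
    (h.eq_of_mul_star_self (by simp [conjTranspose_single]))

/-- Cutting a matrix down to one of its entries does not increase the norm. -/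
theorem single_apply_le (h : IsMatrixCStarNorm N) (X : Matrix (Fin 2) (Fin 2) B)
    (i j : Fin 2) : N (single i j (X i j)) ≤ N X := by
  set Y := single i j (X i j) with hY
  have key : Yᴴ * X * Yᴴ = Yᴴ * Y * Yᴴ := by
    simp only [hY, conjTranspose_single, single_mul_mul_single, single_apply_same]
  have h1 : N (Yᴴ * Y * Yᴴ) ≤ N Y * N X * N Y := by
    rw [← key]
    calc _ ≤ N (Yᴴ * X) * N Yᴴ := h.mul_le _ _
      _ ≤ N Yᴴ * N X * N Yᴴ := mul_le_mul_of_nonneg_right (h.mul_le _ _) (h.nonneg _)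
      _ = _ := by rw [h.conjTranspose]
  have h2 : N Y * N Y * (N Y * N Y) ≤ N (Yᴴ * Y * Yᴴ) * N Y := by
    have := h.star_mul_self (Yᴴ * Y)
    rw [h.star_mul_self Y] at this
    rw [← this, conjTranspose_mul, conjTranspose_conjTranspose, ← mul_assoc]
    exact h.mul_le _ _
  rcases (h.nonneg Y).eq_or_lt with h0 | h0
  · exact h0 ▸ h.nonneg _
  · have h3 : N Y * N Y * (N Y * N Y) ≤ N Y * N X * N Y * N Y :=
      h2.trans (mul_le_mul_of_nonneg_right h1 h0.le)
    refine le_of_mul_le_mul_left (a := N Y * N Y * N Y) ?_ (by positivity)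
    linarith

theorem entry_le (h : IsMatrixCStarNorm N) (X : Matrix (Fin 2) (Fin 2) B) (i j : Fin 2) :
    N (single 0 0 (X i j)) ≤ N X :=
  h.single_eq i j (X i j) ▸ h.single_apply_le X i j

theorem entry_mul_le (h : IsMatrixCStarNorm N) (x y : B) :
    N (single 0 0 (x * y)) ≤ N (single 0 0 x) * N (single 0 0 y) := by
  simpa using h.mul_le (single 0 0 x) (single 0 0 y)

theorem entry_neg (h : IsMatrixCStarNorm N) (x : B) :
    N (single 0 0 (-x)) = N (single 0 0 x) := by
  rw [← h.neg (single 0 0 x), single_neg]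

theorem entry_smul (h : IsMatrixCStarNorm N) (c : ℂ) (x : B) :
    N (single 0 0 (c • x)) = ‖c‖ * N (single 0 0 x) := by
  rw [← h.smul, smul_single]

theorem le_of_entry_le (h : IsMatrixCStarNorm N) {X : Matrix (Fin 2) (Fin 2) B} {r : ℝ}
    (hX : ∀ i j, N (single 0 0 (X i j)) ≤ r) : N X ≤ 4 * r := by
  have hdec : X = (single 0 0 (X 0 0) + single 0 1 (X 0 1)) +
      (single 1 0 (X 1 0) + single 1 1 (X 1 1)) := by
    ext i j
    fin_cases i <;> fin_cases j <;> simp [single]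
  have h1 := h.add_le (single 0 0 (X 0 0) + single 0 1 (X 0 1))
    (single 1 0 (X 1 0) + single 1 1 (X 1 1))
  rw [← hdec] at h1
  have h2 := h.add_le (single 0 0 (X 0 0)) (single 0 1 (X 0 1))
  have h3 := h.add_le (single 1 0 (X 1 0)) (single 1 1 (X 1 1))
  rw [h.single_eq 0 1] at h2
  rw [h.single_eq 1 0, h.single_eq 1 1] at h3
  linarith [hX 0 0, hX 0 1, hX 1 0, hX 1 1]

/-- `diag(cd, -dc)` is the diagonal of a square-zero matrix of controlled norm. -/
theorem exists_sq_zero_diag_mul (h : IsMatrixCStarNorm N) {c d : B} {γ δ : ℝ}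
    (hc : N (single 0 0 c) ≤ γ) (hd : N (single 0 0 d) ≤ δ) :
    ∃ n : Matrix (Fin 2) (Fin 2) B, n * n = 0 ∧ n 0 0 = c * d ∧ n 1 1 = -(d * c) ∧
      N n ≤ 4 * (γ * δ) := by
  have hγ := (h.nonneg _).trans hc
  rcases ((h.nonneg _).trans hd).eq_or_lt with h0 | h0
  · have hd0 : d = 0 := by
      have := (h.eq_zero_iff _).1 (le_antisymm (hd.trans h0.ge) (h.nonneg _))
      simpa using congrFun (congrFun this 0) 0
    subst hd0
    exact ⟨0, by simp, by simp, by simp, by simp [h.zero, ← h0]⟩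
  have hs : (δ : ℂ) ≠ 0 := by exact_mod_cast h0.ne'
  have hcd : N (single 0 0 (c * d)) ≤ γ * δ :=
    (h.entry_mul_le c d).trans (mul_le_mul hc hd (h.nonneg _) hγ)
  have hdc : N (single 0 0 (d * c)) ≤ γ * δ := by
    rw [mul_comm γ]
    exact (h.entry_mul_le d c).trans (mul_le_mul hd hc (h.nonneg _) h0.le)
  have hdcd : N (single 0 0 (d * c * d)) ≤ γ * δ * δ :=
    (h.entry_mul_le _ d).trans (mul_le_mul hdc hd (h.nonneg _) (by positivity))
  refine ⟨!![c * d, (δ : ℂ) • c; -((δ : ℂ)⁻¹ • (d * c * d)), -(d * c)], ?_, rfl, rfl,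
    h.le_of_entry_le ?_⟩
  · ext i j
    generalize (δ : ℂ) = ε at hs ⊢
    fin_cases i <;> fin_cases j <;>
      simp [Matrix.mul_apply, smul_mul_assoc, mul_smul_comm, smul_smul, hs, mul_assoc]
  · have e1 : N (single 0 0 ((δ : ℂ) • c)) ≤ γ * δ := by
      rw [h.entry_smul, Complex.norm_real, Real.norm_of_nonneg h0.le, mul_comm]
      exact mul_le_mul_of_nonneg_right hc h0.le
    have e2 : N (single 0 0 (-((δ : ℂ)⁻¹ • (d * c * d)))) ≤ γ * δ := by
      rw [h.entry_neg, h.entry_smul, norm_inv, Complex.norm_real, Real.norm_of_nonneg h0.le,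
        inv_mul_le_iff₀ h0]
      linarith
    have e3 : N (single 0 0 (-(d * c))) ≤ γ * δ := by rwa [h.entry_neg]
    intro i j
    fin_cases i <;> fin_cases j
    · exact hcd
    · exact e1
    · exact e2
    · exact e3

/-- `diag(x, -x)` is the diagonal of a square-zero matrix of controlled norm. -/
theorem exists_sq_zero_diag_neg (h : IsMatrixCStarNorm N) {x : B} {r : ℝ}
    (hx : N (single 0 0 x) ≤ r) :
    ∃ n : Matrix (Fin 2) (Fin 2) B, n * n = 0 ∧ n 0 0 = x ∧ n 1 1 = -x ∧ N n ≤ 4 * r := by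
  refine ⟨!![x, x; -x, -x], ?_, rfl, rfl, h.le_of_entry_le ?_⟩
  · ext i j
    fin_cases i <;> fin_cases j <;> simp [Matrix.mul_apply]
  · have hx' : N (single 0 0 (-x)) ≤ r := by rwa [h.entry_neg]
    intro i j
    fin_cases i <;> fin_cases j
    · exact hx
    · exact hx
    · exact hx'
    · exact hx'

theorem exists_commutator_eq_sum (h : IsMatrixCStarNorm N)
    (a b : Matrix (Fin 2) (Fin 2) B) :
    ∃ z : Fin 14 → Matrix (Fin 2) (Fin 2) B,
      a * b - b * a = ∑ i, z i ∧ ∀ i, z i * z i = 0 ∧ N (z i) ≤ 26 * N a * N b := by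
  have hneg (i j : Fin 2) : N (single 0 0 (-b i j)) ≤ N b :=
    h.entry_neg (b i j) ▸ h.entry_le b i j
  obtain ⟨p, hp, hp0, hp1, hpN⟩ := h.exists_sq_zero_diag_mul (h.entry_le a 0 1) (h.entry_le b 1 0)
  obtain ⟨q, hq, hq0, hq1, hqN⟩ := h.exists_sq_zero_diag_mul (hneg 0 1) (h.entry_le a 1 0)
  obtain ⟨r, hr, hr0, hr1, hrN⟩ := h.exists_sq_zero_diag_mul (h.entry_le a 0 0) (h.entry_le b 0 0)
  obtain ⟨s, hs, hs0, hs1, hsN⟩ := h.exists_sq_zero_diag_mul (hneg 1 1) (h.entry_le a 1 1)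
  have hba (i : Fin 2) : N (single 0 0 (b i i * a i i)) ≤ N a * N b := by
    rw [mul_comm (N a)]
    exact (h.entry_mul_le _ _).trans
      (mul_le_mul (h.entry_le b i i) (h.entry_le a i i) (h.nonneg _) (h.nonneg _))
  have hx : N (single 0 0 (b 1 1 * a 1 1 - b 0 0 * a 0 0)) ≤ 2 * (N a * N b) := by
    have := h.sub_le (single 0 0 (b 1 1 * a 1 1)) (single 0 0 (b 0 0 * a 0 0))
    have hsub := map_sub (singleAddMonoidHom (0 : Fin 2) (0 : Fin 2)) (b 1 1 * a 1 1)
      (b 0 0 * a 0 0)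
    simp only [singleAddMonoidHom_apply] at hsub
    rw [← hsub] at this
    linarith [hba 0, hba 1]
  obtain ⟨t, ht, ht0, ht1, htN⟩ := h.exists_sq_zero_diag_neg hx
  rw [mul_comm (N b)] at hqN hsN
  have hab : 0 ≤ N a * N b := mul_nonneg (h.nonneg a) (h.nonneg b)
  set w := a * b - b * a - (p + q + r + s + t) with hw
  have hwN : N w ≤ 26 * (N a * N b) := by
    have h1 := h.sub_le (a * b - b * a) (p + q + r + s + t)
    have h2 := h.sub_le (a * b) (b * a)
    have h3 := h.mul_le a b
    have h4 := h.mul_le b a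
    rw [mul_comm (N b)] at h4
    linarith [h.add_le (p + q + r + s) t, h.add_le (p + q + r) s, h.add_le (p + q) r,
      h.add_le p q]
  have hw0 : w 0 0 = 0 := by
    simp only [hw, Matrix.sub_apply, Matrix.add_apply, Matrix.mul_apply, Fin.sum_univ_two,
      hp0, hq0, hr0, hs0, ht0, neg_mul]
    abel
  have hw1 : w 1 1 = 0 := by
    simp only [hw, Matrix.sub_apply, Matrix.add_apply, Matrix.mul_apply, Fin.sum_univ_two,
      hp1, hq1, hr1, hs1, ht1, mul_neg, neg_neg]
    abel
  have hwdec : w = single 0 1 (w 0 1) + single 1 0 (w 1 0) := by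
    ext i j
    fin_cases i <;> fin_cases j <;> simp [single, hw0, hw1]
  refine ⟨![p, q, r, s, t, single 0 1 (w 0 1), single 1 0 (w 1 0), 0, 0, 0, 0, 0, 0, 0], ?_, ?_⟩
  · have hsum : a * b - b * a = p + q + r + s + t + w := by rw [hw]; abel
    rw [hsum]
    nth_rewrite 1 [hwdec]
    simp [Fin.sum_univ_succ]
    abel
  · rw [mul_assoc]
    have hz : (0 : Matrix (Fin 2) (Fin 2) B) * 0 = 0 ∧
        N (0 : Matrix (Fin 2) (Fin 2) B) ≤ 26 * (N a * N b) :=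
      ⟨by simp, by rw [h.zero]; positivity⟩
    have hw01 := (h.single_apply_le w 0 1).trans hwN
    have hw10 := (h.single_apply_le w 1 0).trans hwN
    simp only [Fin.forall_fin_succ]
    refine ⟨⟨hp, ?_⟩, ⟨hq, ?_⟩, ⟨hr, ?_⟩, ⟨hs, ?_⟩, ⟨ht, ?_⟩, ⟨?_, hw01⟩, ⟨?_, hw10⟩,
      hz, hz, hz, hz, hz, hz, hz, fun i => i.elim0⟩
    · exact hpN.trans (by linarith)
    · exact hqN.trans (by linarith)
    · exact hrN.trans (by linarith)
    · exact hsN.trans (by linarith)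
    · exact htN.trans (by linarith)
    · exact single_mul_single_of_ne _ _ _ _ (by decide) _
    · exact single_mul_single_of_ne _ _ _ _ (by decide) _

end IsMatrixCStarNorm

/-- There is a universal constant `C > 0` such that in `M₂(B)`,
for any C*-algebra `B`, every commutator `[a, b]` is a sum of (at most) 14 square-zero
elements, each of norm at most `C·‖a‖·‖b‖`.  The (unique) C*-norm on `M₂(B)` is
represented by a function `Nm` satisfying the C*-norm axioms. -/
theorem statement12 :
    ∃ C : ℝ, 0 < C ∧
      ∀ (B : Type*) [inst : NonUnitalCStarAlgebra B]
        (Nm : Matrix (Fin 2) (Fin 2) B → ℝ),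
        (∀ X, 0 ≤ Nm X) →
        (∀ X, Nm X = 0 ↔ X = 0) →
        (∀ X Y, Nm (X + Y) ≤ Nm X + Nm Y) →
        (∀ (c : ℂ) (X), Nm (c • X) = ‖c‖ * Nm X) →
        (∀ X Y, Nm (X * Y) ≤ Nm X * Nm Y) →
        (∀ X, Nm (X.conjTranspose * X) = Nm X * Nm X) →
        ∀ a b : Matrix (Fin 2) (Fin 2) B,
          ∃ z : Fin 14 → Matrix (Fin 2) (Fin 2) B,
            a * b - b * a = ∑ i, z i ∧
            ∀ i, z i * z i = 0 ∧ Nm (z i) ≤ C * Nm a * Nm b := by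
  refine ⟨26, by norm_num, ?_⟩
  intro B _ Nm h1 h2 h3 h4 h5 h6 a b
  exact IsMatrixCStarNorm.exists_commutator_eq_sum ⟨h1, h2, h3, h4, h5, h6⟩ a b
end

section
/- Let m ∈ ℕ and C > 0, and let A₁, A₂, … be a sequence of C*-algebras, each having commutator bounds (m, C). Let P = ∏_{n=1}^∞ Aₙ be the product C*-algebra of all bounded sequences (aₙ)ₙ with aₙ ∈ Aₙ, with the supremum norm and coordinatewise operations, and for each n let πₙ : P → Aₙ be the coordinate projection. Then the convex hull of the set ⋃_{n=1}^∞ { τ ∘ πₙ : τ ∈ T₁(Aₙ) } is dense in T₁(P) with respect to the weak* topology on the dual of P. -/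
open scoped ENNReal

/-- A trace of norm at most one on a C*-algebra: a continuous linear functional of norm
at most `1` which is positive and vanishes on commutators. -/
def IsTrace1 {B : Type*} [NonUnitalCStarAlgebra B] (τ : B →L[ℂ] ℂ) : Prop :=
  ‖τ‖ ≤ 1 ∧ (∀ x : B, 0 ≤ (τ (star x * x)).re ∧ (τ (star x * x)).im = 0) ∧
    ∀ x y : B, τ (x * y) = τ (y * x)

section TracialFunctionals

variable {A : Type*} [NonUnitalCStarAlgebra A] [PartialOrder A] [StarOrderedRing A]

/-- If `0 ≤ y ≤ x` then `y` is approximately of the form `v⋆xv` with `v` a contraction. -/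
lemma exists_norm_le_one_star_mul_mul_approx {x y : A} (hy : 0 ≤ y) (hyx : y ≤ x)
    {ε : ℝ} (hε : 0 < ε) :
    ∃ v : A, ‖v‖ ≤ 1 ∧ ‖y - star v * x * v‖ ≤ ε := by
  set X : Unitization ℂ A := (x : Unitization ℂ A) with hX
  set Y : Unitization ℂ A := (y : Unitization ℂ A) with hY
  have hY0 : 0 ≤ Y := Unitization.inr_nonneg_iff.2 hy
  have hYX : Y ≤ X := (Unitization.inr_le_iff y x (.of_nonneg hy) (.of_nonneg (hy.trans hyx))).2 hyx
  set Z : Unitization ℂ A := X + algebraMap ℝ _ ε with hZ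
  have hZpos : IsStrictlyPositive Z :=
    IsStrictlyPositive.nonneg_add (hY0.trans hYX) (by
      rw [Algebra.algebraMap_eq_smul_one]; exact IsStrictlyPositive.smul hε isStrictlyPositive_one)
  set w : Unitization ℂ A := Z ^ (-(1 / 2) : ℝ) with hw
  have hw1 : w * Z * w = 1 := CFC.conjugate_rpow_neg_one_half Z hZpos
  have hw0 : 0 ≤ w := CFC.rpow_nonneg
  have hws : star w = w := (IsSelfAdjoint.of_nonneg hw0).star_eq
  have hε0 : (0 : Unitization ℂ A) ≤ algebraMap ℝ _ ε := algebraMap_nonneg _ hε.le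
  have hwY : w * Y * w ≤ 1 := by
    have h : Y ≤ Z := hYX.trans (le_add_of_nonneg_right hε0)
    have := star_left_conjugate_le_conjugate h w
    rwa [hws, hw1] at this
  set s := CFC.sqrt y
  have hss : s * s = y := CFC.sqrt_mul_sqrt_self y
  have hsa : star s = s := (IsSelfAdjoint.of_nonneg (CFC.sqrt_nonneg y)).star_eq
  obtain ⟨v, hv⟩ : ∃ v : A, (v : Unitization ℂ A) = w * (s : Unitization ℂ A) := by
    refine ⟨(w * (s : Unitization ℂ A)).snd, ?_⟩
    ext <;> simp
  have hvn : ‖v‖ ≤ 1 := by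
    have h1 : ‖(v : Unitization ℂ A) * star (v : Unitization ℂ A)‖ ≤ 1 := by
      rw [hv, star_mul, hws, ← Unitization.inr_star, hsa]
      have : w * (s : Unitization ℂ A) * ((s : Unitization ℂ A) * w) = w * Y * w := by
        rw [hY, ← hss, Unitization.inr_mul]; simp only [mul_assoc]
      rw [this]
      refine (CStarAlgebra.norm_le_one_iff_of_nonneg _ ?_).2 hwY
      have := star_left_conjugate_nonneg hY0 w
      rwa [hws] at this
    rw [CStarRing.norm_self_mul_star, Unitization.norm_inr] at h1
    nlinarith [norm_nonneg v]
  refine ⟨v, hvn, ?_⟩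
  have hsv : star (v : Unitization ℂ A) = (s : Unitization ℂ A) * w := by
    rw [hv, star_mul, hws, ← Unitization.inr_star, hsa]
  have key : ((y - star v * x * v : A) : Unitization ℂ A)
      = ε • (star (v : Unitization ℂ A) * v) := by
    rw [Unitization.inr_sub, Unitization.inr_mul, Unitization.inr_mul, Unitization.inr_star,
      ← hX, ← hss, Unitization.inr_mul]
    have e1 : (s : Unitization ℂ A) * s = s * (w * Z * w) * s := by rw [hw1, mul_one]
    rw [e1, hsv, hv, hZ, Algebra.algebraMap_eq_smul_one]
    simp only [mul_add, add_mul, mul_assoc, smul_mul_assoc, mul_smul_comm, one_mul]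
    abel
  rw [← Unitization.norm_inr (𝕜 := ℂ), key, norm_smul, CStarRing.norm_star_mul_self,
    Unitization.norm_inr, Real.norm_of_nonneg hε.le]
  nlinarith [norm_nonneg v, mul_le_one₀ hvn (norm_nonneg v) hvn]

lemma Icc_zero_bddAbove_image (f : A →L[ℝ] ℝ) (x : A) : BddAbove (f '' Set.Icc 0 x) := by
  refine ⟨‖f‖ * ‖x‖, ?_⟩
  rintro _ ⟨y, hy, rfl⟩
  calc f y ≤ ‖f‖ * ‖y‖ := (le_abs_self _).trans (f.le_opNorm y)
    _ ≤ ‖f‖ * ‖x‖ := by gcongr; exact CStarAlgebra.norm_le_norm_of_nonneg_of_le hy.1 hy.2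

/-- The positive part of a functional `f`, evaluated at a positive element `x`: the supremum of
`f` over the order interval `[0, x]`. -/
noncomputable def supIcc (f : A →L[ℝ] ℝ) (x : A) : ℝ := sSup (f '' Set.Icc 0 x)

lemma le_supIcc (f : A →L[ℝ] ℝ) {x y : A} (hy : 0 ≤ y) (hyx : y ≤ x) : f y ≤ supIcc f x :=
  le_csSup (Icc_zero_bddAbove_image f x) ⟨y, ⟨hy, hyx⟩, rfl⟩

set_option linter.unusedSectionVars false in
lemma supIcc_le (f : A →L[ℝ] ℝ) {x : A} (hx : 0 ≤ x) {r : ℝ}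
    (h : ∀ y, 0 ≤ y → y ≤ x → f y ≤ r) : supIcc f x ≤ r := by
  refine csSup_le ⟨f 0, 0, ⟨le_rfl, hx⟩, rfl⟩ ?_
  rintro _ ⟨y, hy, rfl⟩
  exact h y hy.1 hy.2

lemma supIcc_nonneg (f : A →L[ℝ] ℝ) {x : A} (hx : 0 ≤ x) : 0 ≤ supIcc f x := by
  simpa using le_supIcc f le_rfl hx

set_option linter.unusedSectionVars false in
lemma supIcc_zero (f : A →L[ℝ] ℝ) : supIcc f 0 = 0 := by
  simp [supIcc]

/-- A real functional is tracial when it takes the same value on `x⋆x` and `xx⋆`. -/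
def IsTracial (f : A →L[ℝ] ℝ) : Prop := ∀ x : A, f (star x * x) = f (x * star x)

lemma mul_mul_star_le_of_norm_le_one {v : A} (hv : ‖v‖ ≤ 1) (z : A) :
    z * (v * star v) * star z ≤ z * star z := by
  refine (CStarAlgebra.star_right_conjugate_le_norm_smul (.mul_star_self v)).trans ?_
  rw [CStarRing.norm_self_mul_star]
  have h := mul_star_self_nonneg z
  have h1 : ‖v‖ * ‖v‖ ≤ 1 := mul_le_one₀ hv (norm_nonneg v) hv
  simpa using smul_le_smul_of_nonneg_right h1 h

lemma supIcc_le_of_conj (f : A →L[ℝ] ℝ) {x : A} (hx : 0 ≤ x) {r : ℝ}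
    (h : ∀ v : A, ‖v‖ ≤ 1 → f (star v * x * v) ≤ r) : supIcc f x ≤ r := by
  refine supIcc_le f hx fun y hy hyx ↦ le_of_forall_pos_le_add fun ε hε ↦ ?_
  have hf : 0 < ‖f‖ + 1 := by positivity
  obtain ⟨v, hv, hd⟩ := exists_norm_le_one_star_mul_mul_approx hy hyx (div_pos hε hf)
  have h1 : f (y - star v * x * v) ≤ ‖f‖ * (ε / (‖f‖ + 1)) :=
    (le_abs_self _).trans ((f.le_opNorm _).trans (by gcongr))
  have h2 : ‖f‖ * (ε / (‖f‖ + 1)) ≤ ε := by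
    rw [mul_div_assoc', div_le_iff₀ hf]; nlinarith
  rw [map_sub] at h1
  linarith [h v hv]

lemma IsTracial.apply_conj_le_supIcc {f : A →L[ℝ] ℝ} (hf : IsTracial f) {v : A} (hv : ‖v‖ ≤ 1)
    (z : A) : f (star v * (star z * z) * v) ≤ supIcc f (z * star z) := by
  have h := hf (z * v)
  rw [star_mul] at h
  have e1 : star v * (star z * z) * v = star v * star z * (z * v) := by simp only [mul_assoc]
  have e2 : z * v * (star v * star z) = z * (v * star v) * star z := by simp only [mul_assoc]
  rw [e1, h, e2]
  refine le_supIcc f ?_ (mul_mul_star_le_of_norm_le_one hv z)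
  rw [← e2, ← star_mul]
  exact mul_star_self_nonneg _

lemma IsTracial.supIcc_star_mul_self {f : A →L[ℝ] ℝ} (hf : IsTracial f) (z : A) :
    supIcc f (star z * z) = supIcc f (z * star z) := by
  have key (z : A) : supIcc f (star z * z) ≤ supIcc f (z * star z) :=
    supIcc_le_of_conj f (star_mul_self_nonneg z) fun v hv ↦ hf.apply_conj_le_supIcc hv z
  exact le_antisymm (key z) (by simpa using key (star z))

lemma IsTracial.supIcc_add {f : A →L[ℝ] ℝ} (hf : IsTracial f) {x₁ x₂ : A} (h₁ : 0 ≤ x₁)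
    (h₂ : 0 ≤ x₂) : supIcc f (x₁ + x₂) = supIcc f x₁ + supIcc f x₂ := by
  apply le_antisymm
  · have conj {x : A} (hx : 0 ≤ x) {v : A} (hv : ‖v‖ ≤ 1) :
        f (star v * x * v) ≤ supIcc f x := by
      have hs : star (CFC.sqrt x) = CFC.sqrt x :=
        (IsSelfAdjoint.of_nonneg (CFC.sqrt_nonneg x)).star_eq
      simpa [hs, CFC.sqrt_mul_sqrt_self x hx] using hf.apply_conj_le_supIcc hv (CFC.sqrt x)
    refine supIcc_le_of_conj f (add_nonneg h₁ h₂) fun v hv ↦ ?_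
    rw [mul_add, add_mul, map_add]
    exact add_le_add (conj h₁ hv) (conj h₂ hv)
  · rw [← le_sub_iff_add_le]
    refine supIcc_le f h₁ fun y₁ hy₁ hyx₁ ↦ ?_
    rw [le_sub_iff_add_le, ← le_sub_iff_add_le']
    refine supIcc_le f h₂ fun y₂ hy₂ hyx₂ ↦ ?_
    rw [le_sub_iff_add_le', ← map_add]
    exact le_supIcc f (add_nonneg hy₁ hy₂) (add_le_add hyx₁ hyx₂)

lemma supIcc_le_mul_norm (f : A →L[ℝ] ℝ) {x : A} (hx : 0 ≤ x) {α : ℝ}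
    (hα : ∀ y : A, 0 ≤ y → f y ≤ α * ‖y‖) (hα0 : 0 ≤ α) : supIcc f x ≤ α * ‖x‖ :=
  supIcc_le f hx fun y hy hyx ↦ (hα y hy).trans <| by
    gcongr
    exact CStarAlgebra.norm_le_norm_of_nonneg_of_le hy hyx

lemma IsTracial.supIcc_sub_eq {f : A →L[ℝ] ℝ} (hf : IsTracial f) {p q p' q' : A} (hp : 0 ≤ p)
    (hq : 0 ≤ q) (hp' : 0 ≤ p') (hq' : 0 ≤ q') (h : p - q = p' - q') :
    supIcc f p - supIcc f q = supIcc f p' - supIcc f q' := by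
  rw [sub_eq_sub_iff_add_eq_add] at h ⊢
  rw [← hf.supIcc_add hp hq', ← hf.supIcc_add hp' hq, h]

open scoped ComplexStarModule

/-- The value of the positive part of a tracial functional at the real part of `x`. -/
noncomputable def posPartRe (f : A →L[ℝ] ℝ) (x : A) : ℝ :=
  supIcc f (ℜ x : A)⁺ - supIcc f (ℜ x : A)⁻

lemma IsTracial.posPartRe_eq {f : A →L[ℝ] ℝ} (hf : IsTracial f) {x p q : A} (hp : 0 ≤ p)
    (hq : 0 ≤ q) (h : (ℜ x : A) = p - q) : posPartRe f x = supIcc f p - supIcc f q :=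
  hf.supIcc_sub_eq (CFC.posPart_nonneg _) (CFC.negPart_nonneg _) hp hq
    ((CFC.posPart_sub_negPart _ (ℜ x).2).trans h)

lemma IsTracial.posPartRe_add {f : A →L[ℝ] ℝ} (hf : IsTracial f) (x y : A) :
    posPartRe f (x + y) = posPartRe f x + posPartRe f y := by
  rw [hf.posPartRe_eq (x := x + y)
    (add_nonneg (CFC.posPart_nonneg (ℜ x : A)) (CFC.posPart_nonneg (ℜ y : A)))
    (add_nonneg (CFC.negPart_nonneg (ℜ x : A)) (CFC.negPart_nonneg (ℜ y : A))),
    hf.supIcc_add (CFC.posPart_nonneg _) (CFC.posPart_nonneg _),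
    hf.supIcc_add (CFC.negPart_nonneg _) (CFC.negPart_nonneg _), posPartRe, posPartRe]
  · ring
  · rw [map_add, AddSubgroup.coe_add, add_sub_add_comm, CFC.posPart_sub_negPart _ (ℜ x).2,
      CFC.posPart_sub_negPart _ (ℜ y).2]

lemma abs_posPartRe_le (f : A →L[ℝ] ℝ) {α : ℝ} (hα : ∀ y : A, 0 ≤ y → f y ≤ α * ‖y‖)
    (hα0 : 0 ≤ α) (x : A) : |posPartRe f x| ≤ α * ‖x‖ := by
  have hn : ‖(ℜ x : A)‖ ≤ ‖x‖ := realPart.norm_le x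
  have hp := CFC.posPart_nonneg (ℜ x : A)
  have hq := CFC.negPart_nonneg (ℜ x : A)
  have h1 := supIcc_le_mul_norm f hp hα hα0
  have h2 := supIcc_le_mul_norm f hq hα hα0
  have h3 : α * ‖(ℜ x : A)⁺‖ ≤ α * ‖x‖ := by
    gcongr; exact (CStarAlgebra.norm_posPart_le _).trans hn
  have h4 : α * ‖(ℜ x : A)⁻‖ ≤ α * ‖x‖ := by
    gcongr; exact (CStarAlgebra.norm_negPart_le _).trans hn
  rw [posPartRe, abs_le]
  constructor <;> linarith [supIcc_nonneg f hp, supIcc_nonneg f hq]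

set_option linter.unusedSectionVars false in
/-- A complex functional with `τ(x⋆x) = τ(xx⋆)` vanishes on commutators. -/
lemma map_mul_comm_of_star_mul_self (τ : A →L[ℂ] ℂ)
    (h : ∀ x : A, τ (star x * x) = τ (x * star x)) (x y : A) : τ (x * y) = τ (y * x) := by
  have key (x y : A) : τ (star x * y) + τ (star y * x) = τ (y * star x) + τ (x * star y) := by
    have := h (x + y)
    simp only [star_add, add_mul, mul_add, map_add, h x, h y] at this
    linear_combination this
  have h1 := key (star x) y
  have h2 := key (star x) (Complex.I • y)
  simp only [star_star, star_smul, smul_mul_assoc, mul_smul_comm, map_smul, smul_eq_mul,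
    Complex.star_def, Complex.conj_I] at h1 h2
  have hI := Complex.I_mul_I
  linear_combination (1/2) * h1 - (Complex.I / 2) * h2 +
    (1/2) * (τ (x * y) - τ (star y * star x) - τ (y * x) + τ (star x * star y)) * hI

/-- The positive part of a bounded tracial functional is a bounded positive trace. -/
lemma IsTracial.exists_positive_part {f : A →L[ℝ] ℝ} (hf : IsTracial f) {α : ℝ}
    (hα : ∀ y : A, 0 ≤ y → f y ≤ α * ‖y‖) (hα0 : 0 ≤ α) :
    ∃ τ : A →L[ℂ] ℂ, ‖τ‖ ≤ α ∧ (∀ x : A, 0 ≤ x → τ x = supIcc f x) ∧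
      ∀ x y : A, τ (x * y) = τ (y * x) := by
  let G₀ : A →+ ℝ := AddMonoidHom.mk' (posPartRe f) hf.posPartRe_add
  let G : A →L[ℝ] ℝ := G₀.toRealLinearMap
    (AddMonoidHomClass.continuous_of_bound G₀ α (abs_posPartRe_le f hα hα0))
  have hG (x : A) : G x = posPartRe f x := rfl
  let τ : A →L[ℂ] ℂ := StrongDual.extendRCLike (𝕜 := ℂ) G
  have hτ (x : A) (hx : 0 ≤ x) : τ x = supIcc f x := by
    have hsa : IsSelfAdjoint x := .of_nonneg hx
    have e1 : posPartRe f x = supIcc f x := by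
      rw [hf.posPartRe_eq hx le_rfl (by rw [hsa.coe_realPart, sub_zero]), supIcc_zero, sub_zero]
    have e2 : posPartRe f (Complex.I • x) = 0 := by
      rw [hf.posPartRe_eq le_rfl le_rfl (by simp [realPart_I_smul, hsa.imaginaryPart]), sub_self]
    have : τ x = (G x : ℂ) - Complex.I * (G (Complex.I • x) : ℂ) :=
      StrongDual.extendRCLike_apply G x
    rw [this, hG, hG, e1, e2]
    simp
  refine ⟨τ, ?_, hτ, map_mul_comm_of_star_mul_self τ fun x ↦ ?_⟩
  · have : ‖τ‖ = ‖G‖ := StrongDual.norm_extendRCLike G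
    rw [this]
    exact G.opNorm_le_bound hα0 (abs_posPartRe_le f hα hα0)
  · rw [hτ _ (star_mul_self_nonneg x), hτ _ (mul_star_self_nonneg x), hf.supIcc_star_mul_self]

/-- A tracially bounded self-adjoint element is, up to commutators and a small error, a positive
element of controlled norm minus a positive element of controlled norm. -/
lemma exists_sub_add_commutator_approx {a : A} (ha : IsSelfAdjoint a) {r M δ : ℝ} (hr : 0 < r)
    (hM : 0 < M) (haM : ‖a‖ ≤ M) (htr : ∀ σ : A →L[ℂ] ℂ, IsTrace1 σ → (σ a).re ≤ r)
    (hδ : 0 < δ) :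
    ∃ b c h : A, 0 ≤ b ∧ ‖b‖ ≤ r ∧ 0 ≤ c ∧ ‖c‖ ≤ M ∧
      h ∈ closure (Submodule.span ℂ {z : A | ∃ x y : A, z = x * y - y * x} : Set A) ∧
      ‖a - (b - c + h)‖ < δ := by
  set H : Submodule ℂ A := Submodule.span ℂ {z : A | ∃ x y : A, z = x * y - y * x}
  let B (R : ℝ) : Set A := Set.Ici 0 ∩ Metric.closedBall 0 R
  have hB {R : ℝ} {x : A} : x ∈ B R ↔ 0 ≤ x ∧ ‖x‖ ≤ R := by simp [B]
  have hB0 {R : ℝ} (hR : 0 < R) : (0 : A) ∈ B R := hB.2 ⟨le_rfl, by simpa using hR.le⟩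
  have hBc (R : ℝ) : Convex ℝ (B R) := (convex_Ici 0).inter (convex_closedBall 0 R)
  let S : Set A := {x | ∃ b ∈ B r, ∃ c ∈ B M, ∃ h ∈ H, x = b - c + h}
  have hSc : Convex ℝ S := by
    rintro _ ⟨b, hb, c, hc, h, hh, rfl⟩ _ ⟨b', hb', c', hc', h', hh', rfl⟩ s t hs ht hst
    refine ⟨s • b + t • b', hBc r hb hb' hs ht hst, s • c + t • c', hBc M hc hc' hs ht hst,
      s • h + t • h', H.add_mem (H.smul_of_tower_mem s hh) (H.smul_of_tower_mem t hh'), ?_⟩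
    simp only [smul_add, smul_sub]
    abel
  by_cases haS : a ∈ closure S
  · obtain ⟨_, ⟨b, hb, c, hc, h, hh, rfl⟩, hd⟩ := Metric.mem_closure_iff.1 haS δ hδ
    rw [hB] at hb hc
    exact ⟨b, c, h, hb.1, hb.2, hc.1, hc.2, subset_closure hh, by rwa [← dist_eq_norm]⟩
  exfalso
  obtain ⟨f, u, hfS, hfa⟩ := geometric_hahn_banach_closed_point hSc.closure isClosed_closure haS
  have hf {b c h : A} (hb : b ∈ B r) (hc : c ∈ B M) (hh : h ∈ H) : f b - f c + f h < u := by
    simpa using hfS _ (subset_closure ⟨b, hb, c, hc, h, hh, rfl⟩)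
  have hfH {h : A} (hh : h ∈ H) : f h = 0 := by
    by_contra hne
    have := hf (hB0 hr) (hB0 hM) (H.smul_of_tower_mem ((u / f h) : ℝ) hh)
    simp [hne] at this
  have htf : IsTracial f := fun x ↦ by
    rw [← sub_eq_zero, ← map_sub]
    exact hfH (Submodule.subset_span ⟨star x, x, rfl⟩)
  set p := sSup (f '' B r)
  have hfbc {b c : A} (hb : b ∈ B r) (hc : c ∈ B M) : f b - f c < u := by
    simpa using hf hb hc H.zero_mem
  have hbp {b : A} (hb : b ∈ B r) : f b ≤ p := by
    refine le_csSup ⟨u, ?_⟩ ⟨b, hb, rfl⟩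
    rintro _ ⟨x, hx, rfl⟩
    simpa using (hfbc hx (hB0 hM)).le
  have hp0 : 0 ≤ p := by simpa using hbp (hB0 hr)
  have hpc {c : A} (hc : c ∈ B M) : -f c ≤ u - p := by
    have : p ≤ u + f c := by
      refine csSup_le ⟨_, 0, hB0 hr, rfl⟩ ?_
      rintro _ ⟨x, hx, rfl⟩
      linarith [hfbc hx hc]
    linarith
  have hfp (y : A) (hy : 0 ≤ y) : f y ≤ p / r * ‖y‖ := by
    rcases eq_or_ne y 0 with rfl | hne
    · simp
    have hn : 0 < ‖y‖ := norm_pos_iff.2 hne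
    have hmem : (r / ‖y‖) • y ∈ B r := by
      refine hB.2 ⟨smul_nonneg (by positivity) hy, ?_⟩
      rw [norm_smul, Real.norm_of_nonneg (by positivity), div_mul_cancel₀ _ hn.ne']
    have := hbp hmem
    rw [map_smul, smul_eq_mul, div_mul_eq_mul_div, div_le_iff₀ hn] at this
    rw [div_mul_eq_mul_div, le_div_iff₀ hr]
    linarith
  obtain ⟨τ, hτn, hτ, hτc⟩ := htf.exists_positive_part hfp (by positivity)
  have hτa : (τ a).re ≤ p := by
    rcases hp0.eq_or_lt with h0 | hp
    · have : τ = 0 := by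
        rw [← norm_le_zero_iff]; simpa [← h0] using hτn
      simp [this, hp0]
    have h1 : IsTrace1 (((r / p : ℝ) : ℂ) • τ) := by
      refine ⟨?_, fun x ↦ ?_, fun x y ↦ ?_⟩
      · rw [norm_smul, Complex.norm_real, Real.norm_of_nonneg (by positivity)]
        calc r / p * ‖τ‖ ≤ r / p * (p / r) := by gcongr
          _ = 1 := by field_simp
      · have hx := star_mul_self_nonneg x
        simp only [_root_.smul_apply, hτ _ hx, smul_eq_mul, ← Complex.ofReal_mul,
          Complex.ofReal_re, Complex.ofReal_im, and_true]
        exact mul_nonneg (by positivity) (supIcc_nonneg f hx)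
      · simp [hτc x y]
    have h2 := htr _ h1
    rw [_root_.smul_apply, smul_eq_mul, Complex.re_ofReal_mul,
      div_mul_eq_mul_div, div_le_iff₀ hp] at h2
    exact le_of_mul_le_mul_left h2 hr
  have hP := CFC.posPart_nonneg a
  have hN := CFC.negPart_nonneg a
  have hdec := CFC.posPart_sub_negPart a ha
  have hτa' : (τ a).re = supIcc f a⁺ - supIcc f a⁻ := by
    conv_lhs => rw [← hdec]
    simp [hτ _ hP, hτ _ hN]
  have hfa' : f a = f a⁺ - f a⁻ := by
    conv_lhs => rw [← hdec]
    simp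
  have h1 : f a⁺ ≤ supIcc f a⁺ := le_supIcc f hP le_rfl
  have h2 : supIcc f a⁻ ≤ f a⁻ + (u - p) := supIcc_le f hN fun y hy hya ↦ by
    have hmem : a⁻ - y ∈ B M := by
      refine hB.2 ⟨sub_nonneg.2 hya, ?_⟩
      refine (CStarAlgebra.norm_le_norm_of_nonneg_of_le (sub_nonneg.2 hya)
        (sub_le_self _ hy)).trans ?_
      exact (CStarAlgebra.norm_negPart_le a).trans haM
    have := hpc hmem
    rw [map_sub] at this
    linarith
  linarith

lemma IsTrace1.map_nonneg {τ : A →L[ℂ] ℂ} (hτ : IsTrace1 τ) {x : A} (hx : 0 ≤ x) :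
    0 ≤ (τ x).re ∧ (τ x).im = 0 := by
  have hs : star (CFC.sqrt x) = CFC.sqrt x :=
    (IsSelfAdjoint.of_nonneg (CFC.sqrt_nonneg x)).star_eq
  simpa [hs, CFC.sqrt_mul_sqrt_self x hx] using hτ.2.1 (CFC.sqrt x)

lemma IsTrace1.map_isSelfAdjoint_im {τ : A →L[ℂ] ℂ} (hτ : IsTrace1 τ) {x : A}
    (hx : IsSelfAdjoint x) : (τ x).im = 0 := by
  rw [← CFC.posPart_sub_negPart x hx]
  simp [(hτ.map_nonneg (CFC.posPart_nonneg x)).2, (hτ.map_nonneg (CFC.negPart_nonneg x)).2]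

end TracialFunctionals

lemma IsTrace1.re_map_star {B : Type*} [NonUnitalCStarAlgebra B] {τ : B →L[ℂ] ℂ}
    (hτ : IsTrace1 τ) (x : B) : (τ (star x)).re = (τ x).re := by
  let _ := CStarAlgebra.spectralOrder B
  have := CStarAlgebra.spectralOrderedRing B
  have hsa : IsSelfAdjoint (Complex.I • (x - star x)) := by
    rw [isSelfAdjoint_iff]
    simp only [star_smul, star_sub, star_star, Complex.star_def, Complex.conj_I, smul_sub, neg_smul]
    abel
  have h := hτ.map_isSelfAdjoint_im hsa
  simp at h
  linarith

lemma exists_normalized_commutator {B : Type*} [NonUnitalCStarAlgebra B] (x y : B) {D : ℝ}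
    (hD : 0 ≤ D) (h : ‖x‖ * ‖y‖ ≤ D) :
    ∃ x' y' : B, ‖x'‖ ≤ 1 ∧ ‖y'‖ ≤ D ∧ x' * y' - y' * x' = x * y - y * x := by
  rcases eq_or_ne x 0 with rfl | hx
  · exact ⟨0, 0, by simp, by simpa, by simp⟩
  have hn : ‖x‖ ≠ 0 := norm_ne_zero_iff.2 hx
  refine ⟨(‖x‖⁻¹ : ℝ) • x, ‖x‖ • y, ?_, ?_, ?_⟩
  · rw [norm_smul, norm_inv, norm_norm, inv_mul_cancel₀ hn]
  · rwa [norm_smul, norm_norm]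
  · simp [smul_mul_smul_comm, hn]

/-- A positive bound on all norm-one traces of the coordinates of `a` bounds the norm-one traces
of the product algebra at `a`. -/
lemma IsTrace1.re_le_of_forall_trace {A : ℕ → Type*} [∀ n, NonUnitalCStarAlgebra (A n)]
    {m : ℕ} {C : ℝ} (hbounds : ∀ n, HasCommutatorBounds (A n) m C) {τ : lp A ∞ →L[ℂ] ℂ}
    (hτ : IsTrace1 τ) (a : lp A ∞) {u : ℝ} (hu : 0 < u)
    (ha : ∀ n, ∀ σ : A n →L[ℂ] ℂ, IsTrace1 σ → (σ (a n)).re ≤ u) : (τ a).re ≤ u := by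
  let _ (n : ℕ) := CStarAlgebra.spectralOrder (A n)
  have _ (n : ℕ) := CStarAlgebra.spectralOrderedRing (A n)
  have re_half {B : Type _} [NonUnitalCStarAlgebra B] {σ : B →L[ℂ] ℂ} (hσ : IsTrace1 σ) (x : B) :
      (σ ((1 / 2 : ℂ) • (x + star x))).re = (σ x).re := by
    have h2 : (1 / 2 : ℂ) = ((1 / 2 : ℝ) : ℂ) := by norm_num
    rw [h2, map_smul, map_add, smul_eq_mul, Complex.re_ofReal_mul, Complex.add_re,
      hσ.re_map_star]
    ring
  set a' : lp A ∞ := (1 / 2 : ℂ) • (a + star a) with ha'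
  have ha'n (n : ℕ) : a' n = (1 / 2 : ℂ) • (a n + star (a n)) := rfl
  rw [← re_half hτ a, ← ha']
  have hsa (n : ℕ) : IsSelfAdjoint (a' n) := by
    rw [ha'n, isSelfAdjoint_iff]
    simp [add_comm]
  set M : ℝ := ‖a'‖ + 1
  have hM : 0 < M := by positivity
  have haM (n : ℕ) : ‖a' n‖ ≤ M := (lp.norm_apply_le_norm (by simp) a' n).trans (by simp [M])
  refine le_of_forall_pos_le_add fun δ hδ ↦ ?_
  have hδ2 : 0 < δ / 2 := by positivity
  choose b c h hb0 hb hc0 hc hh hd using fun n ↦ exists_sub_add_commutator_approx (hsa n) hu hM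
    (haM n) (fun σ hσ ↦ by rw [ha'n, re_half hσ]; exact ha n σ hσ) hδ2
  set R : ℝ := δ / 2 + (M + (u + M))
  have hhR (n : ℕ) : ‖h n‖ ≤ R := by
    have e : h n = -(a' n - (b n - c n + h n)) + (a' n - (b n - c n)) := by abel
    rw [e]
    refine (norm_add_le _ _).trans (add_le_add (by rw [norm_neg]; exact (hd n).le) ?_)
    refine (norm_sub_le _ _).trans (add_le_add (haM n) ?_)
    exact (norm_sub_le _ _).trans (add_le_add (hb n) (hc n))
  choose x y hxy hxyC using fun n ↦ hbounds n (h n) (hh n) (δ / 2) hδ2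
  set D : ℝ := |C| * R
  have hD (n : ℕ) (i : Fin m) : ‖x n i‖ * ‖y n i‖ ≤ D := calc
    ‖x n i‖ * ‖y n i‖ ≤ ∑ i, ‖x n i‖ * ‖y n i‖ :=
      Finset.single_le_sum (f := fun i ↦ ‖x n i‖ * ‖y n i‖) (fun _ _ ↦ by positivity)
        (Finset.mem_univ i)
    _ ≤ C * ‖h n‖ := hxyC n
    _ ≤ |C| * R := mul_le_mul (le_abs_self C) (hhR n) (norm_nonneg _) (abs_nonneg C)
  have hD0 : 0 ≤ D := by positivity
  choose x' y' hx' hy' hxy' using fun n i ↦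
    exists_normalized_commutator (x n i) (y n i) hD0 (hD n i)
  have mem {z : ∀ n, A n} {K : ℝ} (hz : ∀ n, ‖z n‖ ≤ K) : Memℓp z ∞ :=
    memℓp_infty ⟨K, by rintro _ ⟨n, rfl⟩; exact hz n⟩
  let b' : lp A ∞ := ⟨b, mem hb⟩
  let c' : lp A ∞ := ⟨c, mem hc⟩
  let X (i : Fin m) : lp A ∞ := ⟨fun n ↦ x' n i, mem fun n ↦ hx' n i⟩
  let Y (i : Fin m) : lp A ∞ := ⟨fun n ↦ y' n i, mem fun n ↦ hy' n i⟩
  let s : lp A ∞ := ⟨fun n ↦ CFC.sqrt (c n), mem (K := √M) fun n ↦ by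
    rw [CFC.norm_sqrt _ (hc0 n)]; exact Real.sqrt_le_sqrt (hc n)⟩
  let K : lp A ∞ := ∑ i, (X i * Y i - Y i * X i)
  have hK : τ K = 0 := by
    simp [K, hτ.2.2 (X _) (Y _)]
  have hKn (n : ℕ) : K n = ∑ i, (x n i * y n i - y n i * x n i) := by
    have : K n = ∑ i, (X i * Y i - Y i * X i : lp A ∞) n := by
      simp only [K, lp.coeFn_sum, Finset.sum_apply]
    rw [this]
    exact Finset.sum_congr rfl fun i _ ↦ hxy' n i
  have hE : ‖a' - (b' - c' + K)‖ ≤ δ := by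
    refine lp.norm_le_of_forall_le hδ.le fun n ↦ ?_
    have e : (a' - (b' - c' + K) : lp A ∞) n
        = (a' n - (b n - c n + h n)) + (h n - ∑ i, (x n i * y n i - y n i * x n i)) := by
      rw [← hKn]
      change a' n - (b n - c n + K n) = _
      abel
    rw [e]
    exact (norm_add_le _ _).trans (by linarith [hd n, hxy n])
  have bound (z : lp A ∞) : (τ z).re ≤ ‖z‖ :=
    (Complex.re_le_norm _).trans ((τ.le_opNorm z).trans
      (mul_le_of_le_one_left (norm_nonneg z) hτ.1))
  have hb' : (τ b').re ≤ u := (bound b').trans (lp.norm_le_of_forall_le hu.le hb)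
  have hc' : 0 ≤ (τ c').re := by
    have : c' = star s * s := by
      ext n
      change c n = star (CFC.sqrt (c n)) * CFC.sqrt (c n)
      rw [(IsSelfAdjoint.of_nonneg (CFC.sqrt_nonneg (c n))).star_eq,
        CFC.sqrt_mul_sqrt_self _ (hc0 n)]
    rw [this]
    exact (hτ.2.1 s).1
  have hE' := (bound _).trans hE
  simp only [map_sub, map_add, hK, Complex.sub_re, Complex.add_re, Complex.zero_re] at hE'
  linarith

/-- Let `A₁, A₂, …` be C*-algebras, each with commutator bounds
`(m, C)`, and let `P = ∏ₙ Aₙ` be the product C*-algebra (bounded sequences, sup norm;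
realized as `lp A ∞`).  Then the convex hull of `⋃ₙ {τ ∘ πₙ : τ ∈ T₁(Aₙ)}` is
weak*-dense in `T₁(P)`: every `τ ∈ T₁(P)` is approximated, uniformly on any finite
set of elements of `P`, by elements of this convex hull. -/
theorem statement15 (A : ℕ → Type*) [∀ n, NonUnitalCStarAlgebra (A n)]
    (m : ℕ) (C : ℝ) (hbounds : ∀ n, HasCommutatorBounds (A n) m C) :
    ∀ τ : lp A ∞ →L[ℂ] ℂ, IsTrace1 τ →
      ∀ (k : ℕ) (a : Fin k → lp A ∞) (ε : ℝ), 0 < ε →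
        ∃ σ ∈ convexHull ℝ
          {φ : lp A ∞ →L[ℂ] ℂ | ∃ (n : ℕ) (σ' : A n →L[ℂ] ℂ), IsTrace1 σ' ∧
            ∀ f : lp A ∞, φ f = σ' ((f : ∀ i, A i) n)},
          ∀ i, ‖τ (a i) - σ (a i)‖ < ε := by
  intro τ hτ k a ε hε
  set T : Set (lp A ∞ →L[ℂ] ℂ) := {φ | ∃ (n : ℕ) (σ' : A n →L[ℂ] ℂ), IsTrace1 σ' ∧
    ∀ f : lp A ∞, φ f = σ' ((f : ∀ i, A i) n)}
  let Φ : (lp A ∞ →L[ℂ] ℂ) → (Fin k → ℂ) := fun φ i ↦ φ (a i)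
  have hΦ : IsLinearMap ℝ Φ := ⟨fun _ _ ↦ rfl, fun _ _ ↦ rfl⟩
  have hconv : Convex ℝ (Φ '' convexHull ℝ T) := (convex_convexHull ℝ T).is_linear_image hΦ
  by_cases hmem : Φ τ ∈ closure (Φ '' convexHull ℝ T)
  · obtain ⟨_, ⟨σ, hσ, rfl⟩, hd⟩ := Metric.mem_closure_iff.1 hmem ε hε
    refine ⟨σ, hσ, fun i ↦ ?_⟩
    rw [← dist_eq_norm]
    exact (dist_le_pi_dist (Φ τ) (Φ σ) i).trans_lt hd
  exfalso
  obtain ⟨f, u, hf, hu⟩ := RCLike.geometric_hahn_banach_closed_point (𝕜 := ℂ) hconv.closure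
    isClosed_closure hmem
  set a₀ : lp A ∞ := ∑ i, f (Pi.single i 1) • a i
  have hfΦ (φ : lp A ∞ →L[ℂ] ℂ) : f (Φ φ) = φ a₀ := by
    have e : Φ φ = ∑ i, φ (a i) • (Pi.single i 1 : Fin k → ℂ) := by
      ext j
      simp [Φ, Finset.sum_apply, Pi.single_apply]
    rw [e]
    simp [a₀, mul_comm]
  have hT {n : ℕ} {σ : A n →L[ℂ] ℂ} (hσ : IsTrace1 σ) : (σ (a₀ n)).re < u := by
    have h : σ.comp (lp.evalCLM ℂ A ∞ n) ∈ T := ⟨n, σ, hσ, fun _ ↦ rfl⟩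
    have := hf _ (subset_closure ⟨_, subset_convexHull ℝ T h, rfl⟩)
    rw [hfΦ] at this
    exact this
  have hu0 : 0 < u := by
    have h0 : IsTrace1 (0 : A 0 →L[ℂ] ℂ) := ⟨by simp, by simp, by simp⟩
    simpa using hT h0
  have := hτ.re_le_of_forall_trace hbounds a₀ hu0 fun n σ hσ ↦ (hT hσ).le
  rw [hfΦ] at hu
  exact absurd hu (not_lt.2 this)
end
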